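/- arXiv:2307.09453 — 2 statements merged into one kernel-verified Lean document; each statement's English description precedes it below -/
import Mathlib

section
/- Let N ≥ 3 be odd, S = Z/NZ, V = F^S with the cycle graph structure as in case (b), and let Vbar = V/(F·e_S) with the induced nondegenerate symplectic form and the vectors ebar_s = pi(e_s), where pi: V → Vbar is the quotient map. Then the triple (Vbar,<.,.>,(ebar_s)) is perfect; moreover in this case the union of the subspaces L_B over B in phi(Vbar) is all of Vbar, so that B ↦ eps(B) is a bijection from phi(Vbar) onto Vbar. -/
/-- The induced subgraph of `adj` on `I` is a path (type `A_m`, `m ≥ 1`):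
there is an injective enumeration `f : Fin (m+1) → S` of `I` such that two
elements of `I` are adjacent iff they are consecutive in the enumeration. -/
def IsPathOn {S : Type} [DecidableEq S] (adj : S → S → Prop) (I : Finset S) : Prop :=
  ∃ (m : ℕ) (f : Fin (m + 1) → S), Function.Injective f ∧
    I = Finset.image f Finset.univ ∧
    ∀ i j : Fin (m + 1), adj (f i) (f j) ↔ ((i : ℕ) + 1 = (j : ℕ) ∨ (j : ℕ) + 1 = (i : ℕ))

/-- The induced subgraph of `adj` on `I` is connected. -/
def ConnOn {S : Type} (adj : S → S → Prop) (I : Finset S) : Prop :=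
  ∀ s ∈ I, ∀ t ∈ I, Relation.ReflTransGen (fun a b => a ∈ I ∧ b ∈ I ∧ adj a b) s t

/-- `I ∈ Cal_I^1`: the induced subgraph on `I` is a path and `|I|` is odd. -/
def CalI1 {S : Type} [DecidableEq S] (adj : S → S → Prop) (I : Finset S) : Prop :=
  IsPathOn adj I ∧ Odd I.card

/-- `I ≺ I'`. -/
def Prec {S : Type} [DecidableEq S] (adj : S → S → Prop) (I I' : Finset S) : Prop :=
  I ⊂ I' ∧ ¬ ConnOn adj (I' \ I)

/-- `I ♠ I'`. -/
def Spade {S : Type} [DecidableEq S] (adj : S → S → Prop) (I I' : Finset S) : Prop :=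
  I ∩ I' = ∅ ∧ ¬ ConnOn adj (I ∪ I')

/-- `I^{ev}`: the set of `s ∈ I` such that `I ∖ {s}` is the disjoint union of
`I', I'' ∈ Cal_I^1` with `I' ♠ I''`. -/
def Iev {S : Type} [DecidableEq S] (adj : S → S → Prop) (I : Finset S) : Set S :=
  {s | s ∈ I ∧ ∃ I' I'' : Finset S, CalI1 adj I' ∧ CalI1 adj I'' ∧
    Spade adj I' I'' ∧ I.erase s = I' ∪ I''}

/-- Property (P0). -/
def P0 {S : Type} [DecidableEq S] (adj : S → S → Prop) (B : Finset (Finset S)) : Prop :=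
  ∀ I ∈ B, ∀ I' ∈ B, I = I' ∨ Spade adj I I' ∨ Prec adj I I' ∨ Prec adj I' I

/-- Property (P1). -/
def P1 {S : Type} [DecidableEq S] (adj : S → S → Prop) (B : Finset (Finset S)) : Prop :=
  ∀ I ∈ B, ∃ (k : ℕ) (f : Fin k → Finset S),
    (∀ j, f j ∈ B ∧ Prec adj (f j) I) ∧
    (∀ j j', j ≠ j' → Disjoint (f j) (f j')) ∧
    Iev adj I ⊆ ⋃ j, ((f j : Finset S) : Set S)

/-- `phi`: finite sets `B` of elements of `Cal_I^1` satisfying (P0) and (P1). -/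
def phiSet {S : Type} [DecidableEq S] (adj : S → S → Prop) : Set (Finset (Finset S)) :=
  {B | (∀ I ∈ B, CalI1 adj I) ∧ P0 adj B ∧ P1 adj B}

/-- `supp(B)`. -/
def suppB {S : Type} [DecidableEq S] (B : Finset (Finset S)) : Finset S := B.biUnion id

/-- `g_s(B)`. -/
def gs {S : Type} [DecidableEq S] (B : Finset (Finset S)) (s : S) : ℕ :=
  (B.filter (fun I => s ∈ I)).card

/-- `e_I = ∑_{s ∈ I} e_s`. -/
def eSum {S : Type} {V : Type} [AddCommGroup V] [Module (ZMod 2) V]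
    (e : S → V) (I : Finset S) : V := ∑ s ∈ I, e s

/-- `L_B`: the `F`-span of `{e_I : I ∈ B}`. -/
def LB {S : Type} {V : Type} [AddCommGroup V] [Module (ZMod 2) V]
    (e : S → V) (B : Finset (Finset S)) : Submodule (ZMod 2) V :=
  Submodule.span (ZMod 2) ((fun I => eSum e I) '' (B : Set (Finset S)))

/-- `eps(B) = ∑_{s ∈ S} ((g_s(B)(g_s(B)+1)/2) mod 2) e_s`. -/
def epsB {S : Type} [DecidableEq S] [Fintype S] {V : Type} [AddCommGroup V]
    [Module (ZMod 2) V] (e : S → V) (B : Finset (Finset S)) : V :=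
  ∑ s : S, ((gs B s * (gs B s + 1) / 2 : ℕ) : ZMod 2) • e s

/-- The triple `(V, <,>, e)` (with graph `adj`) is perfect. -/
def IsPerfect {S : Type} [DecidableEq S] [Fintype S] {V : Type} [AddCommGroup V]
    [Module (ZMod 2) V] (adj : S → S → Prop) (e : S → V) : Prop :=
  (∀ B ∈ phiSet adj,
      (LinearIndependent (ZMod 2) (fun I : {I : Finset S // I ∈ B} => eSum e I.1)) ∧
      (∀ I : Finset S, CalI1 adj I → (eSum e I ∈ LB e B ↔ I ∈ B))) ∧
  (∀ B ∈ phiSet adj, epsB e B ∈ LB e B) ∧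
  Set.BijOn (epsB e) (phiSet adj) (⋃ B ∈ phiSet adj, ((LB e B : Submodule (ZMod 2) V) : Set V)) ∧
  (∀ B ∈ phiSet adj, ∀ B' ∈ phiSet adj, epsB e B' ∈ LB e B → ∀ s : S, gs B' s ≤ gs B s)
/-- Adjacency of the cycle of length `N` on `S = ZMod N`. -/
def cadj (N : ℕ) (i j : ZMod N) : Prop := j = i + 1 ∨ i = j + 1

/-- `V = F^S` for `S = ZMod N`. -/
abbrev Vc (N : ℕ) := ZMod N → ZMod 2

/-- The standard basis vector `e_s`. -/
def eVec (N : ℕ) (s : ZMod N) : Vc N := Pi.single s 1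

/-- The line `F·e_S`, where `e_S = ∑_{s ∈ S} e_s`. -/
def radN (N : ℕ) [NeZero N] : Submodule (ZMod 2) (Vc N) :=
  Submodule.span (ZMod 2) {eSum (eVec N) Finset.univ}

/-- `Vbar = V / (F·e_S)`. -/
abbrev VbarN (N : ℕ) [NeZero N] := Vc N ⧸ radN N

/-- The quotient map `pi : V → Vbar`. -/
def piQ (N : ℕ) [NeZero N] : Vc N →ₗ[ZMod 2] VbarN N := (radN N).mkQ

/-- `ebar_s = pi(e_s)`. -/
def ebar (N : ℕ) [NeZero N] (s : ZMod N) : VbarN N := piQ N (eVec N s)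
open scoped Classical in
/-- The connected component of `s` in the induced subgraph of `adj` on `I`. -/
noncomputable def compOf {S : Type} [DecidableEq S] (adj : S → S → Prop)
    (I : Finset S) (s : S) : Finset S :=
  I.filter (fun t => Relation.ReflTransGen (fun a b => a ∈ I ∧ b ∈ I ∧ adj a b) s t)

/-- `c(I)`: the set of vertex sets of connected components of the induced subgraph on `I`. -/
noncomputable def comps {S : Type} [DecidableEq S] (adj : S → S → Prop)
    (I : Finset S) : Finset (Finset S) :=
  I.image (compOf adj I)

/-- `|c^0(I)|`: the number of connected components of even cardinality. -/
noncomputable def c0card {S : Type} [DecidableEq S] (adj : S → S → Prop)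
    (I : Finset S) : ℕ :=
  ((comps adj I).filter (fun C => Even C.card)).card

/-- `V_0 = {e_I : I ⊊ S with |c^0(I)| even}`. -/
def V0set (N : ℕ) [NeZero N] : Set (Vc N) :=
  {v | ∃ I : Finset (ZMod N), I ≠ Finset.univ ∧ Even (c0card (cadj N) I) ∧
    v = eSum (eVec N) I}

/-- `V_1 = {e_S} ∪ {e_I : ∅ ≠ I ⊊ S with |c^0(I)| odd}`. -/
def V1set (N : ℕ) [NeZero N] : Set (Vc N) :=
  {v | v = eSum (eVec N) Finset.univ ∨ ∃ I : Finset (ZMod N), I ≠ ∅ ∧ I ≠ Finset.univ ∧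
    Odd (c0card (cadj N) I) ∧ v = eSum (eVec N) I}
open scoped Classical in
/-- `I^{odd} = I ∖ I^{ev}` (as a `Finset`). -/
noncomputable def IoddF {S : Type} [DecidableEq S] (adj : S → S → Prop)
    (I : Finset S) : Finset S :=
  I.filter (fun s => s ∉ Iev adj I)

/-- `n_B = |{I ∈ B : ee ⊆ I}|`. -/
def nB {S : Type} [DecidableEq S] (ee : Finset S) (B : Finset (Finset S)) : ℕ :=
  (B.filter (fun I => ee ⊆ I)).card

open scoped Classical in
/-- `B ↦ B^!`: remove the unique `I_B ∈ B` with `|I_B ∩ ee| = 1` when `n_B` is odd;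
leave `B` unchanged when `n_B` is even. -/
noncomputable def bangF {S : Type} [DecidableEq S] (ee : Finset S)
    (B : Finset (Finset S)) : Finset (Finset S) :=
  if h : Odd (nB ee B) ∧ ∃ I ∈ B, (I ∩ ee).card = 1 then B.erase h.2.choose else B

/-- `omega = {B^! : B ∈ phi}`. -/
def omegaSet {S : Type} [DecidableEq S] (adj : S → S → Prop) (ee : Finset S) :
    Set (Finset (Finset S)) :=
  (bangF ee) '' (phiSet adj)

open scoped Classical in
/-- `Btilde`: the unique element of `phi` with `Btilde^! = B`. -/
noncomputable def tildeF {S : Type} [DecidableEq S] (adj : S → S → Prop) (ee : Finset S)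
    (C : Finset (Finset S)) : Finset (Finset S) :=
  if h : ∃ B ∈ phiSet adj, bangF ee B = C then h.choose else ∅

/-- `'eps(B) = eps(Btilde)`. -/
noncomputable def epsO {S : Type} [DecidableEq S] [Fintype S] {V : Type} [AddCommGroup V]
    [Module (ZMod 2) V] (adj : S → S → Prop) (ee : Finset S) (e : S → V)
    (C : Finset (Finset S)) : V :=
  epsB e (tildeF adj ee C)

/-- `B' ⪯ B` on `omega`. -/
def preceqO {S : Type} [DecidableEq S] [Fintype S] {V : Type} [AddCommGroup V]
    [Module (ZMod 2) V] (adj : S → S → Prop) (ee : Finset S) (e : S → V)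
    (B' B : Finset (Finset S)) : Prop :=
  ∃ (k : ℕ) (c : ℕ → Finset (Finset S)), c 0 = B' ∧ c k = B ∧
    (∀ i ≤ k, c i ∈ omegaSet adj ee) ∧
    (∀ i < k, epsO adj ee e (c i) ∈ LB e (c (i + 1)))

/-- The linear form `v ↦ v t + v t'` on `V`. -/
def zeeV (N : ℕ) (t t' : ZMod N) : Vc N →ₗ[ZMod 2] ZMod 2 :=
  (LinearMap.proj t : Vc N →ₗ[ZMod 2] ZMod 2) + (LinearMap.proj t' : Vc N →ₗ[ZMod 2] ZMod 2)

/-- `z_ee : Vbar → F`, the linear map with `z_ee(ebar_s) = 1` iff `s ∈ ee = {t,t'}`. -/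
noncomputable def zee (N : ℕ) [NeZero N] (t t' : ZMod N) : VbarN N →ₗ[ZMod 2] ZMod 2 :=
  Submodule.liftQ (radN N) (zeeV N t t') (by
    rw [radN, Submodule.span_le, Set.singleton_subset_iff]
    have h1 : ∀ u : ZMod N, (eSum (eVec N) Finset.univ) u = 1 := by
      intro u
      simp [eSum, eVec, Finset.sum_apply, Finset.sum_pi_single]
    simp only [SetLike.mem_coe, LinearMap.mem_ker, zeeV, LinearMap.add_apply,
      LinearMap.proj_apply, h1]
    decide)
/-- The maximal elements of a finite family of finsets, under inclusion. -/
def maxElts {S : Type} [DecidableEq S] (C : Finset (Finset S)) : Finset (Finset S) :=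
  C.filter (fun I => ∀ I' ∈ C, ¬ I ⊂ I')

/-- `restB B k = B ∖ (B_1 ∪ … ∪ B_k)`: what remains of `B` after removing the first
`k` layers; the `k`-th layer (`k ≥ 1`) is `B_k = maxElts (restB B (k-1))`. -/
def restB {S : Type} [DecidableEq S] (B : Finset (Finset S)) : ℕ → Finset (Finset S)
  | 0 => B
  | k + 1 => restB B k \ maxElts (restB B k)

/-- The relation `B' ≤ B` on `phi(V)`. -/
def lePhi {S : Type} [DecidableEq S] [Fintype S] {V : Type} [AddCommGroup V]
    [Module (ZMod 2) V] (adj : S → S → Prop) (e : S → V)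
    (B' B : Finset (Finset S)) : Prop :=
  ∃ (k : ℕ) (c : ℕ → Finset (Finset S)), c 0 = B' ∧ c k = B ∧
    (∀ i ≤ k, c i ∈ phiSet adj) ∧
    (∀ i < k, epsB e (c i) ∈ LB e (c (i + 1)))


/-! ### Sequences -/

def StepR (a b : ℕ) : Prop := b = a + 1 ∨ a = b + 1 ∨ (a = 0 ∧ b = 0)

lemma seq_par (G : ℕ → ℕ) (hG : ∀ i, StepR (G i) (G (i + 1))) (i n : ℕ)
    (hpos : ∀ k ≤ n, 0 < G (i + k)) : G (i + n) % 2 = (G i + n) % 2 := by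
  induction n with
  | zero => simp
  | succ n ih =>
    have h1 := ih (fun k hk => hpos k (by omega))
    have h2 := hG (i + n)
    have h3 := hpos n (by omega)
    have h4 := hpos (n + 1) (by omega)
    unfold StepR at h2
    rw [show i + (n + 1) = i + n + 1 by ring] at *
    omega

lemma seq_claim (G : ℕ → ℕ) (F : ℕ → ZMod 2) (P : ℕ → ℤ)
    (hG : ∀ i, StepR (G i) (G (i + 1)))
    (hF : ∀ i n, G (i + n) = G i → (∀ k ≤ n, G i ≤ G (i + k)) → F (i + n) = F i)
    (hP : ∀ i, P i + P (i + 1) = if F i = F (i + 1) then 0 else 1) :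
    ∀ n i, G (i + n) = G i → (∀ k ≤ n, G i ≤ G (i + k)) → P (i + n) = (-1) ^ n * P i := by
  intro n
  induction n using Nat.strong_induction_on with
  | _ n ih =>
    intro i hn hk
    rcases Nat.eq_zero_or_pos n with rfl | hnpos
    · simp
    have hs := hG i
    have h1 := hk 1 hnpos
    have hex : ∃ k, 1 ≤ k ∧ G (i + k) = G i := ⟨n, hnpos, hn⟩
    obtain ⟨k, hkk⟩ : ∃ k, k = Nat.find hex := ⟨_, rfl⟩
    have hk1 : 1 ≤ k ∧ G (i + k) = G i := hkk ▸ Nat.find_spec hex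
    have hkmin : ∀ m, 1 ≤ m → m < k → G (i + m) ≠ G i := by
      intro m hm1 hm2 h
      exact Nat.find_min hex (hkk ▸ hm2) ⟨hm1, h⟩
    have hkn : k ≤ n := hkk ▸ Nat.find_min' hex ⟨hnpos, hn⟩
    have hkP : P (i + k) = (-1) ^ k * P i := by
      rcases Nat.eq_or_lt_of_le hk1.1 with hk' | hk'
      · subst hk'
        rw [← hkk] at *
        have hf := hF i 1 hk1.2 (fun m hm => hk m (by omega))
        have hp := hP i
        rw [hf] at hp
        simp at hp
        simp
        linarith
      · have hlow : ∀ m, 1 ≤ m → m < k → G i + 1 ≤ G (i + m) := by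
          intro m h1 h2
          have := hkmin m h1 h2
          have := hk m (by omega)
          omega
        have ha := hlow 1 le_rfl hk'
        have hb := hlow (k - 1) (by omega) (by omega)
        have hs2 := hG (i + (k - 1))
        rw [show i + (k - 1) + 1 = i + k by omega] at hs2
        unfold StepR at hs hs2
        have e1 : G (i + 1) = G i + 1 := by omega
        have e2 : G (i + (k - 1)) = G i + 1 := by omega
        have hlev : G (i + 1 + (k - 2)) = G (i + 1) := by
          rw [show i + 1 + (k - 2) = i + (k - 1) by omega]; omega
        have hge : ∀ m ≤ k - 2, G (i + 1) ≤ G (i + 1 + m) := by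
          intro m hm
          rw [e1, show i + 1 + m = i + (1 + m) by omega]
          exact hlow _ (by omega) (by omega)
        have hI := ih (k - 2) (by omega) (i + 1) hlev hge
        have hpar := seq_par G hG (i + 1) (k - 2) (fun m hm => by have := hge m hm; omega)
        have hev : Even (k - 2) := by rw [Nat.even_iff]; omega
        have hev2 : Even k := by rw [Nat.even_iff] at *; omega
        have hf1 := hF (i + 1) (k - 2) hlev hge
        have hf2 := hF i k hk1.2 (fun m hm => hk m (by omega))
        have hp1 := hP i
        have hp2 := hP (i + (k - 1))
        rw [show i + 1 + (k - 2) = i + (k - 1) by omega] at hI hf1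
        rw [show i + (k - 1) + 1 = i + k by omega] at hp2
        rw [hf1, hf2] at hp2
        rw [hev.neg_one_pow] at hI
        rw [hev2.neg_one_pow]
        simp only [eq_comm] at hp1 hp2
        split_ifs at hp1 hp2 <;> linarith
    have hI := ih (n - k) (by omega) (i + k)
      (by rw [show i + k + (n - k) = i + n by omega, hn, hk1.2])
      (fun m hm => by
        rw [hk1.2, show i + k + m = i + (k + m) by omega]; exact hk _ (by omega))
    rw [show i + k + (n - k) = i + n by omega, hkP, ← mul_assoc, ← pow_add,
      show n - k + k = n by omega] at hI
    exact hI

def pOf (g : ℕ) : ℤ := if g % 2 = 0 then -((g / 2 : ℕ) : ℤ) else (((g + 1) / 2 : ℕ) : ℤ)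

def gOf (p : ℤ) : ℕ := if 0 < p then (2 * p - 1).toNat else (-2 * p).toNat

lemma pOf_gOf (p : ℤ) : pOf (gOf p) = p := by
  unfold pOf gOf; split_ifs <;> omega

lemma gOf_pOf (g : ℕ) : gOf (pOf g) = g := by
  unfold pOf gOf; split_ifs <;> omega

lemma pOf_inj {a b : ℕ} (h : pOf a = pOf b) : a = b := by
  rw [← gOf_pOf a, h, gOf_pOf]

lemma gOf_step (p q : ℤ) (h : p + q = 0 ∨ p + q = 1) : StepR (gOf p) (gOf q) := by
  unfold StepR gOf; split_ifs <;> omega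

lemma pOf_step (a b : ℕ) (h : StepR a b) : pOf a + pOf b = 0 ∨ pOf a + pOf b = 1 := by
  unfold StepR at h; unfold pOf; split_ifs <;> omega

lemma tri_cast (g : ℕ) : ((g * (g + 1) / 2 : ℕ) : ZMod 2) = ((pOf g : ℤ) : ZMod 2) := by
  have : ((g * (g + 1) / 2 : ℕ) : ℤ) % 2 = pOf g % 2 := by
    obtain ⟨k, rfl | rfl | rfl | rfl⟩ : ∃ k, g = 4 * k ∨ g = 4 * k + 1 ∨ g = 4 * k + 2 ∨ g = 4 * k + 3 :=
      ⟨g / 4, by omega⟩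
    · rw [show 4 * k * (4 * k + 1) = 2 * (2 * (k * (4 * k + 1))) by ring]
      unfold pOf; split_ifs <;> omega
    · rw [show (4 * k + 1) * (4 * k + 1 + 1) = 2 * (2 * (k * (4 * k + 3)) + 1) by ring]
      unfold pOf; split_ifs <;> omega
    · rw [show (4 * k + 2) * (4 * k + 2 + 1) = 2 * (2 * (k * (4 * k + 5) + 1) + 1) by ring]
      unfold pOf; split_ifs <;> omega
    · rw [show (4 * k + 3) * (4 * k + 3 + 1) = 2 * (2 * ((4 * k + 3) * (k + 1))) by ring]
      unfold pOf; split_ifs <;> omega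
  have h2 := (ZMod.intCast_eq_intCast_iff _ _ 2).2 (show _ ≡ _ [ZMOD 2] from this)
  rwa [Int.cast_natCast] at h2

lemma pOf_step_if (a b : ℕ) (h : StepR a b) :
    pOf a + pOf b = if ((a * (a + 1) / 2 : ℕ) : ZMod 2) = ((b * (b + 1) / 2 : ℕ) : ZMod 2)
      then 0 else 1 := by
  simp only [tri_cast, ZMod.intCast_eq_intCast_iff]
  have := pOf_step a b h
  unfold Int.ModEq
  split_ifs <;> push_cast at * <;> omega

/-! ### Arcs -/

def arc (N : ℕ) (c : ZMod N) (n : ℕ) : Finset (ZMod N) :=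
  (Finset.range n).image (fun i : ℕ => c + (i : ZMod N))

lemma mem_arc {N : ℕ} {c s : ZMod N} {n : ℕ} : s ∈ arc N c n ↔ ∃ i < n, c + (i : ZMod N) = s := by
  simp [arc]

lemma mem_arc_of {N : ℕ} (c : ZMod N) {n i : ℕ} (h : i < n) : c + (i : ZMod N) ∈ arc N c n :=
  mem_arc.2 ⟨i, h, rfl⟩

lemma cast_inj_lt {N i j : ℕ} (hi : i < N) (hj : j < N) (h : (i : ZMod N) = (j : ZMod N)) :
    i = j := by
  have := (ZMod.natCast_eq_natCast_iff i j N).1 h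
  exact Nat.ModEq.eq_of_lt_of_lt this hi hj

lemma add_cast_inj {N i j : ℕ} {c : ZMod N} (hi : i < N) (hj : j < N)
    (h : c + (i : ZMod N) = c + (j : ZMod N)) : i = j :=
  cast_inj_lt hi hj (add_left_cancel h)

lemma mem_arc_iff {N i n : ℕ} {c : ZMod N} (hi : i < N) (hn : n ≤ N) :
    c + (i : ZMod N) ∈ arc N c n ↔ i < n := by
  constructor
  · intro h
    obtain ⟨j, hj, h⟩ := mem_arc.1 h
    have := add_cast_inj (by omega) hi h
    omega
  · exact mem_arc_of c

lemma sub_one_eq {N : ℕ} (hN : 0 < N) (c : ZMod N) : c - 1 = c + ((N - 1 : ℕ) : ZMod N) := by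
  rw [Nat.cast_sub hN]; simp [sub_eq_add_neg]

lemma pred_notMem_arc {N n : ℕ} {c : ZMod N} (hn : n < N) : c - 1 ∉ arc N c n := by
  rw [sub_one_eq (by omega), mem_arc_iff (by omega) hn.le]; omega

lemma end_notMem_arc {N n : ℕ} {c : ZMod N} (hn : n < N) : c + (n : ZMod N) ∉ arc N c n := by
  rw [mem_arc_iff hn hn.le]; omega

lemma start_mem_arc {N n : ℕ} {c : ZMod N} (hn : 0 < n) : c ∈ arc N c n := by
  simpa using mem_arc_of c hn

lemma card_arc {N n : ℕ} {c : ZMod N} (hn : n ≤ N) : (arc N c n).card = n := by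
  rw [arc, Finset.card_image_of_injOn, Finset.card_range]
  intro i hi j hj h
  simp at hi hj
  exact add_cast_inj (by omega) (by omega) h

/-- every element is at an offset -/
lemma exists_offset {N : ℕ} [NeZero N] (c s : ZMod N) : ∃ i < N, c + (i : ZMod N) = s :=
  ⟨(s - c).val, ZMod.val_lt _, by simp⟩

lemma cadj_symm {N : ℕ} {a b : ZMod N} (h : cadj N a b) : cadj N b a := Or.symm h

lemma path_arc {N : ℕ} (hN : 3 ≤ N) {I : Finset (ZMod N)} (h : IsPathOn (cadj N) I) :
    ∃ c n, 1 ≤ n ∧ n < N ∧ I = arc N c n := by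
  have : NeZero N := ⟨by omega⟩
  obtain ⟨m, f, hf, rfl, hadj⟩ := h
  have hcard : m + 1 ≤ N := by
    have := Fintype.card_le_of_injective f hf
    simpa [ZMod.card] using this
  rcases Nat.eq_zero_or_pos m with rfl | hm
  · refine ⟨f 0, 1, le_rfl, by omega, ?_⟩
    ext s
    simp [mem_arc, eq_comm]
  have key : ∃ ε : ZMod N, (ε = 1 ∨ ε = -1) ∧ ∀ i (hi : i < m + 1), f ⟨i, hi⟩ = f 0 + i * ε := by
    have h01 := (hadj ⟨0, by omega⟩ ⟨1, by omega⟩).2 (Or.inl rfl)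
    obtain ⟨ε, hε, h1⟩ : ∃ ε : ZMod N, (ε = 1 ∨ ε = -1) ∧ f ⟨1, by omega⟩ = f 0 + ε := by
      rcases h01 with h | h
      · exact ⟨1, Or.inl rfl, h⟩
      · refine ⟨-1, Or.inr rfl, ?_⟩
        have : f 0 = f ⟨1, by omega⟩ + 1 := h
        rw [this]; ring
    refine ⟨ε, hε, ?_⟩
    intro i
    induction i using Nat.strong_induction_on with
    | _ i ih =>
      intro hi
      match i, ih, hi with
      | 0, _, _ => simp
      | 1, _, _ => simpa using h1
      | i + 2, ih, hi =>
        have e1 := ih (i + 1) (by omega) (by omega)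
        have e0 := ih i (by omega) (by omega)
        have ha := (hadj ⟨i + 1, by omega⟩ ⟨i + 2, hi⟩).2 (Or.inl rfl)
        have hne : f ⟨i + 2, hi⟩ ≠ f ⟨i, by omega⟩ := by
          intro h
          have := hf h
          simp at this
        have : f ⟨i + 2, hi⟩ = f ⟨i + 1, by omega⟩ + ε := by
          rcases ha with h | h <;> rcases hε with rfl | rfl
          · exact h
          · exact absurd (by rw [h, e1, e0]; push_cast; ring) hne
          · exact absurd (by rw [eq_sub_of_add_eq h.symm, e1, e0]; push_cast; ring) hne
          · rw [h]; ring
        rw [this, e1]; push_cast; ring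
  obtain ⟨ε, hε, hfi⟩ := key
  have hlt : m + 1 < N := by
    rcases Nat.lt_or_ge (m + 1) N with h | h
    · exact h
    exfalso
    have hmN : m + 1 = N := by omega
    have hc : ((m : ℕ) : ZMod N) = -1 := by
      have : ((m + 1 : ℕ) : ZMod N) = 0 := by rw [hmN]; simp
      push_cast at this
      exact eq_neg_of_add_eq_zero_left this
    have hm' := hfi m (by omega)
    have hadj' := hadj ⟨m, by omega⟩ ⟨0, by omega⟩
    have : cadj N (f ⟨m, by omega⟩) (f ⟨0, by omega⟩) := by
      rw [hm', hc]
      have : f ⟨0, by omega⟩ = f 0 := rfl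
      rw [this]
      rcases hε with rfl | rfl
      · left; ring
      · right; ring
    have := hadj'.1 this
    simp at this
    omega
  rcases hε with rfl | rfl
  · refine ⟨f 0, m + 1, by omega, hlt, ?_⟩
    ext s
    simp only [Finset.mem_image, Finset.mem_univ, true_and, mem_arc]
    constructor
    · rintro ⟨⟨i, hi⟩, rfl⟩
      exact ⟨i, hi, by rw [hfi i hi]; ring⟩
    · rintro ⟨i, hi, rfl⟩
      exact ⟨⟨i, hi⟩, by rw [hfi i hi]; ring⟩
  · refine ⟨f 0 - m, m + 1, by omega, hlt, ?_⟩
    ext s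
    simp only [Finset.mem_image, Finset.mem_univ, true_and, mem_arc]
    constructor
    · rintro ⟨⟨i, hi⟩, rfl⟩
      exact ⟨m - i, by omega, by rw [hfi i hi, Nat.cast_sub (by omega)]; ring⟩
    · rintro ⟨i, hi, rfl⟩
      exact ⟨⟨m - i, by omega⟩, by rw [hfi (m - i) (by omega), Nat.cast_sub (by omega)]; ring⟩

lemma arc_path {N n : ℕ} (c : ZMod N) (h1 : 1 ≤ n) (hn : n < N) : IsPathOn (cadj N) (arc N c n) := by
  refine ⟨n - 1, fun i => c + ((i : ℕ) : ZMod N), ?_, ?_, ?_⟩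
  · intro i j h
    exact Fin.ext (add_cast_inj (by omega) (by omega) h)
  · ext s
    simp only [Finset.mem_image, Finset.mem_univ, true_and, mem_arc]
    constructor
    · rintro ⟨i, hi, rfl⟩
      exact ⟨⟨i, by omega⟩, rfl⟩
    · rintro ⟨⟨i, hi⟩, rfl⟩
      exact ⟨i, by omega, rfl⟩
  · intro i j
    have key : ∀ a b : ℕ, a < n → b < n →
        (c + (b : ZMod N) = c + (a : ZMod N) + 1 ↔ a + 1 = b) := by
      intro a b ha hb
      constructor
      · intro h
        have : c + ((a + 1 : ℕ) : ZMod N) = c + (b : ZMod N) := by rw [h]; push_cast; ring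
        exact add_cast_inj (by omega) (by omega) this
      · rintro rfl; push_cast; ring
    unfold cadj
    rw [key _ _ (by omega) (by omega), key _ _ (by omega) (by omega)]

lemma arc_conn {N n : ℕ} (c : ZMod N) : ConnOn (cadj N) (arc N c n) := by
  have key : ∀ i, i < n →
      Relation.ReflTransGen (fun a b => a ∈ arc N c n ∧ b ∈ arc N c n ∧ cadj N a b) c (c + (i : ZMod N)) ∧
      Relation.ReflTransGen (fun a b => a ∈ arc N c n ∧ b ∈ arc N c n ∧ cadj N a b) (c + (i : ZMod N)) c := by
    intro i
    induction i with
    | zero => intro _; simp [Relation.ReflTransGen.refl]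
    | succ i ih =>
      intro hi
      obtain ⟨a, b⟩ := ih (by omega)
      have e : c + ((i + 1 : ℕ) : ZMod N) = c + (i : ZMod N) + 1 := by push_cast; ring
      have m1 := mem_arc_of c (show i < n by omega)
      have m2 := mem_arc_of c hi
      exact ⟨a.tail ⟨m1, m2, Or.inl e⟩, Relation.ReflTransGen.head ⟨m2, m1, Or.inr e⟩ b⟩
  intro s hs t ht
  obtain ⟨i, hi, rfl⟩ := mem_arc.1 hs
  obtain ⟨j, hj, rfl⟩ := mem_arc.1 ht
  exact (key i hi).2.trans (key j hj).1

/-- connectivity from a closed subset -/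
lemma not_conn_of_closed {N : ℕ} {I U : Finset (ZMod N)} {s t : ZMod N} (hs : s ∈ I) (ht : t ∈ I)
    (hsU : s ∈ U) (htU : t ∉ U) (hcl : ∀ a ∈ U, ∀ b ∈ I, cadj N a b → b ∈ U) :
    ¬ ConnOn (cadj N) I := by
  intro h
  have h1 := h s hs t ht
  apply htU
  clear ht htU
  induction h1 with
  | refl => exact hsU
  | tail _ hbc ih => exact hcl _ ih _ hbc.2.1 hbc.2.2

lemma conn_union {N : ℕ} {I J : Finset (ZMod N)} (hI : ConnOn (cadj N) I) (hJ : ConnOn (cadj N) J)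
    {a b : ZMod N} (ha : a ∈ I) (hb : b ∈ J) (hab : cadj N a b) : ConnOn (cadj N) (I ∪ J) := by
  have m1 : ∀ s ∈ I, ∀ t ∈ I, Relation.ReflTransGen
      (fun a b => a ∈ I ∪ J ∧ b ∈ I ∪ J ∧ cadj N a b) s t := fun s hs t ht =>
    Relation.ReflTransGen.mono (fun x y h => ⟨Finset.mem_union_left _ h.1, Finset.mem_union_left _ h.2.1, h.2.2⟩) _ _ (hI s hs t ht)
  have m2 : ∀ s ∈ J, ∀ t ∈ J, Relation.ReflTransGen
      (fun a b => a ∈ I ∪ J ∧ b ∈ I ∪ J ∧ cadj N a b) s t := fun s hs t ht =>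
    Relation.ReflTransGen.mono (fun x y h => ⟨Finset.mem_union_right _ h.1, Finset.mem_union_right _ h.2.1, h.2.2⟩) _ _ (hJ s hs t ht)
  have a' := Finset.mem_union_left J ha
  have b' := Finset.mem_union_right I hb
  intro s hs t ht
  rcases Finset.mem_union.1 hs with hs | hs <;> rcases Finset.mem_union.1 ht with ht | ht
  · exact m1 s hs t ht
  · exact ((m1 s hs a ha).tail ⟨a', b', hab⟩).trans (m2 b hb t ht)
  · exact ((m2 s hs b hb).tail ⟨b', a', cadj_symm hab⟩).trans (m1 a ha t ht)
  · exact m2 s hs t ht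

def Far {N : ℕ} (I J : Finset (ZMod N)) : Prop := ∀ s ∈ I, s ∉ J ∧ s + 1 ∉ J ∧ s - 1 ∉ J
def Ins {N : ℕ} (I J : Finset (ZMod N)) : Prop := ∀ s ∈ I, s ∈ J ∧ s + 1 ∈ J ∧ s - 1 ∈ J

lemma Far.symm {N : ℕ} {I J : Finset (ZMod N)} (h : Far I J) : Far J I := by
  intro s hs
  refine ⟨fun h' => (h s h').1 hs, fun h' => (h _ h').2.2 (by simpa using hs),
    fun h' => (h _ h').2.1 (by simpa using hs)⟩

lemma spade_iff {N : ℕ} {I J : Finset (ZMod N)} (hI : ConnOn (cadj N) I) (hJ : ConnOn (cadj N) J)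
    (hI0 : I.Nonempty) (hJ0 : J.Nonempty) : Spade (cadj N) I J ↔ Far I J := by
  constructor
  · rintro ⟨h1, h2⟩ s hs
    refine ⟨fun h => ?_, fun h => ?_, fun h => ?_⟩
    · have := Finset.mem_inter.2 ⟨hs, h⟩
      rw [h1] at this; simp at this
    · exact h2 (conn_union hI hJ hs h (Or.inl rfl))
    · exact h2 (conn_union hI hJ hs h (Or.inr (by ring)))
  · intro h
    refine ⟨?_, ?_⟩
    · rw [← Finset.disjoint_iff_inter_eq_empty, Finset.disjoint_left]
      exact fun s hs => (h s hs).1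
    · obtain ⟨a, ha⟩ := hI0
      obtain ⟨b, hb⟩ := hJ0
      refine not_conn_of_closed (U := I) (Finset.mem_union_left _ ha) (Finset.mem_union_right _ hb) ha
        (fun hb' => (h b hb').1 hb) ?_
      intro x hx y hy hxy
      rcases Finset.mem_union.1 hy with hy | hy
      · exact hy
      · rcases hxy with rfl | rfl
        · exact absurd hy (h x hx).2.1
        · exact absurd hy (by simpa using (h _ hx).2.2)

lemma arc_sub_arc {N m n : ℕ} {a c : ZMod N} (hm : 1 ≤ m) (hn : n < N)
    (h : arc N a m ⊆ arc N c n) : ∃ i, i + m ≤ n ∧ a = c + (i : ZMod N) := by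
  obtain ⟨i, hi, rfl⟩ := mem_arc.1 (h (start_mem_arc hm))
  refine ⟨i, ?_, rfl⟩
  by_contra hlt
  have h1 : c + (i : ZMod N) + ((n - i : ℕ) : ZMod N) ∈ arc N (c + (i : ZMod N)) m :=
    mem_arc_of _ (by omega)
  have h2 := h h1
  rw [add_assoc, ← Nat.cast_add, show i + (n - i) = n by omega] at h2
  exact end_notMem_arc hn h2

lemma prec_iff {N m n : ℕ} {a c : ZMod N} (hm : 1 ≤ m) (hn : n < N) :
    Prec (cadj N) (arc N a m) (arc N c n) ↔ Ins (arc N a m) (arc N c n) := by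
  have off : ∀ i j : ℕ, c + (i : ZMod N) + (j : ZMod N) = c + ((i + j : ℕ) : ZMod N) := by
    intro i j; push_cast; ring
  constructor
  · rintro ⟨h1, h2⟩
    obtain ⟨i, hi, rfl⟩ := arc_sub_arc hm hn h1.1
    have hi0 : i ≠ 0 := by
      rintro rfl
      apply h2
      have : arc N c n \ arc N (c + ((0 : ℕ) : ZMod N)) m = arc N (c + (m : ZMod N)) (n - m) := by
        ext s
        simp only [Finset.mem_sdiff, Nat.cast_zero, add_zero]
        constructor
        · rintro ⟨hs, hs2⟩
          obtain ⟨j, hj, rfl⟩ := mem_arc.1 hs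
          have : m ≤ j := by
            by_contra hlt
            exact hs2 (mem_arc_of c (by omega))
          refine mem_arc.2 ⟨j - m, by omega, ?_⟩
          rw [off, show m + (j - m) = j by omega]
        · intro hs
          obtain ⟨j, hj, rfl⟩ := mem_arc.1 hs
          rw [off, mem_arc_iff (by omega) (by omega), mem_arc_iff (by omega) (by omega)]
          omega
      rw [this]
      exact arc_conn _
    have hin : i + m ≠ n := by
      intro hin
      apply h2
      have : arc N c n \ arc N (c + (i : ZMod N)) m = arc N c i := by
        ext s
        simp only [Finset.mem_sdiff]
        constructor
        · rintro ⟨hs, hs2⟩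
          obtain ⟨j, hj, rfl⟩ := mem_arc.1 hs
          have : j < i := by
            by_contra hlt
            apply hs2
            refine mem_arc.2 ⟨j - i, by omega, ?_⟩
            rw [off, show i + (j - i) = j by omega]
          exact mem_arc_of c this
        · intro hs
          obtain ⟨j, hj, rfl⟩ := mem_arc.1 hs
          refine ⟨mem_arc_of c (by omega), ?_⟩
          intro hs2
          obtain ⟨k, hk, h⟩ := mem_arc.1 hs2
          rw [off] at h
          have := add_cast_inj (by omega) (by omega) h
          omega
      rw [this]
      exact arc_conn _
    intro s hs
    obtain ⟨j, hj, rfl⟩ := mem_arc.1 hs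
    refine ⟨?_, ?_, ?_⟩
    · rw [off]; exact mem_arc_of c (by omega)
    · rw [off, add_assoc, ← Nat.cast_succ]; exact mem_arc_of c (by omega)
    · rw [off, show c + ((i + j : ℕ) : ZMod N) - 1 = c + ((i + j - 1 : ℕ) : ZMod N) by
        rw [Nat.cast_sub (by omega)]; push_cast; ring]
      exact mem_arc_of c (by omega)
  · intro h
    have hsub : arc N a m ⊆ arc N c n := fun s hs => (h s hs).1
    obtain ⟨i, hi, rfl⟩ := arc_sub_arc hm hn hsub
    have hst : c ∉ arc N (c + (i : ZMod N)) m := by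
      intro hc
      exact pred_notMem_arc hn (h c hc).2.2
    have hen : c + ((n - 1 : ℕ) : ZMod N) ∉ arc N (c + (i : ZMod N)) m := by
      intro hc
      have := (h _ hc).2.1
      rw [add_assoc, ← Nat.cast_succ, show (n - 1).succ = n by omega] at this
      exact end_notMem_arc hn this
    have hi0 : i ≠ 0 := by
      rintro rfl
      exact hst (by simpa using start_mem_arc (c := c) hm)
    have hin : i + m ≠ n := by
      intro hin
      apply hen
      rw [show n - 1 = i + (m - 1) by omega, ← off]
      exact mem_arc_of _ (by omega)
    refine ⟨⟨hsub, fun h' => hst (h' (start_mem_arc (by omega)))⟩, ?_⟩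
    refine not_conn_of_closed (U := arc N c i) (s := c) (t := c + ((n - 1 : ℕ) : ZMod N)) ?_ ?_ ?_ ?_ ?_
    · exact Finset.mem_sdiff.2 ⟨start_mem_arc (by omega), hst⟩
    · exact Finset.mem_sdiff.2 ⟨mem_arc_of c (by omega), hen⟩
    · exact start_mem_arc (by omega)
    · rw [mem_arc_iff (by omega) (by omega)]; omega
    · intro x hx y hy hxy
      obtain ⟨j, hj, rfl⟩ := mem_arc.1 hx
      obtain ⟨hy1, hy2⟩ := Finset.mem_sdiff.1 hy
      obtain ⟨k, hk, rfl⟩ := mem_arc.1 hy1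
      have hki : k < i := by
        rcases hxy with h | h
        · have : c + (k : ZMod N) = c + ((j + 1 : ℕ) : ZMod N) := by rw [h]; push_cast; ring
          have := add_cast_inj (by omega) (by omega) this
          rcases Nat.lt_or_ge k i with h' | h'
          · exact h'
          · have : k = i := by omega
            subst this
            exact absurd (start_mem_arc hm) hy2
        · have : c + (j : ZMod N) = c + ((k + 1 : ℕ) : ZMod N) := by rw [h]; push_cast; ring
          have := add_cast_inj (by omega) (by omega) this
          omega
      exact mem_arc_of c hki

lemma calI1_iff {N : ℕ} (hN : 3 ≤ N) (I : Finset (ZMod N)) :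
    CalI1 (cadj N) I ↔ ∃ c n, n < N ∧ Odd n ∧ I = arc N c n := by
  constructor
  · rintro ⟨h1, h2⟩
    obtain ⟨c, n, _, hn, rfl⟩ := path_arc hN h1
    rw [card_arc hn.le] at h2
    exact ⟨c, n, hn, h2, rfl⟩
  · rintro ⟨c, n, hn, ho, rfl⟩
    exact ⟨arc_path c ho.pos hn, by rwa [card_arc hn.le]⟩

lemma iev_arc {N : ℕ} (hN : 3 ≤ N) {c : ZMod N} {n i : ℕ} (hn : n < N) (hno : Odd n) (hi : i < n) :
    c + (i : ZMod N) ∈ Iev (cadj N) (arc N c n) ↔ Odd i := by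
  have off : ∀ i j : ℕ, c + (i : ZMod N) + (j : ZMod N) = c + ((i + j : ℕ) : ZMod N) := by
    intro i j; push_cast; ring
  have herase : (arc N c n).erase (c + (i : ZMod N)) =
      arc N c i ∪ arc N (c + ((i + 1 : ℕ) : ZMod N)) (n - 1 - i) := by
    ext s
    simp only [Finset.mem_erase, Finset.mem_union]
    constructor
    · rintro ⟨h1, h2⟩
      obtain ⟨j, hj, rfl⟩ := mem_arc.1 h2
      have hji : j ≠ i := by rintro rfl; exact h1 rfl
      rcases Nat.lt_or_gt_of_ne hji with h | h
      · left; exact mem_arc_of c h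
      · right
        refine mem_arc.2 ⟨j - (i + 1), by omega, ?_⟩
        rw [off, show i + 1 + (j - (i + 1)) = j by omega]
    · rintro (h | h)
      · obtain ⟨j, hj, rfl⟩ := mem_arc.1 h
        refine ⟨fun h => ?_, mem_arc_of c (by omega)⟩
        have := add_cast_inj (by omega) (by omega) h
        omega
      · obtain ⟨j, hj, rfl⟩ := mem_arc.1 h
        rw [off]
        refine ⟨fun h => ?_, mem_arc_of c (by omega)⟩
        have := add_cast_inj (by omega) (by omega) h
        omega
  have hfar : Far (arc N c i) (arc N (c + ((i + 1 : ℕ) : ZMod N)) (n - 1 - i)) := by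
    have key : ∀ k, k ≤ i ∨ k = N - 1 → c + (k : ZMod N) ∉ arc N (c + ((i + 1 : ℕ) : ZMod N)) (n - 1 - i) := by
      intro k hk h
      obtain ⟨l, hl, h⟩ := mem_arc.1 h
      rw [off] at h
      have := add_cast_inj (by omega) (by omega) h
      omega
    intro s hs
    obtain ⟨j, hj, rfl⟩ := mem_arc.1 hs
    refine ⟨key j (by omega), ?_, ?_⟩
    · rw [add_assoc, ← Nat.cast_succ]; exact key _ (by omega)
    · rcases Nat.eq_zero_or_pos j with rfl | hj0
      · rw [Nat.cast_zero, add_zero, sub_one_eq (by omega)]; exact key _ (by omega)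
      · rw [show c + ((j : ℕ) : ZMod N) - 1 = c + ((j - 1 : ℕ) : ZMod N) by
          rw [Nat.cast_sub (by omega)]; push_cast; ring]
        exact key _ (by omega)
  constructor
  · rintro ⟨_, I', I'', hI', hI'', hsp, hE⟩
    by_contra hev
    rw [Nat.not_odd_iff_even] at hev
    obtain ⟨c', n', hn', ho', rfl⟩ := (calI1_iff hN I').1 hI'
    obtain ⟨c'', n'', hn'', ho'', rfl⟩ := (calI1_iff hN I'').1 hI''
    have hf' := (spade_iff (arc_conn _) (arc_conn _) ⟨_, start_mem_arc ho'.pos⟩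
      ⟨_, start_mem_arc ho''.pos⟩).1 hsp
    rw [herase] at hE
    -- an arc inside the erased set is inside the first or disjoint from it
    have dich : ∀ b k, arc N b k ⊆ arc N c' n' ∪ arc N c'' n'' →
        arc N b k ⊆ arc N c' n' ∨ Disjoint (arc N b k) (arc N c' n') := by
      intro b k hsub
      by_cases hb : b ∈ arc N c' n'
      · left
        intro s hs
        obtain ⟨j, hj, rfl⟩ := mem_arc.1 hs
        clear hs
        induction j with
        | zero => simpa using hb
        | succ j ih =>
          have h1 := ih (by omega)
          have h2 := hsub (mem_arc_of b hj)
          rcases Finset.mem_union.1 h2 with h2 | h2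
          · exact h2
          · rw [Nat.cast_succ, ← add_assoc] at h2
            exact absurd h2 (hf' _ h1).2.1
      · right
        rw [Finset.disjoint_left]
        intro s hs
        obtain ⟨j, hj, rfl⟩ := mem_arc.1 hs
        clear hs
        induction j with
        | zero => simpa using hb
        | succ j ih =>
          have h1 := ih (by omega)
          have h2 := hsub (mem_arc_of b (show j < k by omega))
          rcases Finset.mem_union.1 h2 with h2 | h2
          · exact absurd h2 h1
          · intro h3
            have := (hf' _ h3).2.2
            rw [Nat.cast_succ, ← add_assoc, add_sub_cancel_right] at this
            exact this h2
    have hd1 := dich _ _ (hE ▸ Finset.subset_union_left)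
    have hd2 := dich _ _ (hE ▸ Finset.subset_union_right)
    have hsub : arc N c' n' ⊆ arc N c i ∪ arc N (c + ((i + 1 : ℕ) : ZMod N)) (n - 1 - i) :=
      hE ▸ Finset.subset_union_left
    have hdis : Disjoint (arc N c i) (arc N (c + ((i + 1 : ℕ) : ZMod N)) (n - 1 - i)) :=
      Finset.disjoint_left.2 fun s hs => (hfar s hs).1
    have hcI := card_arc (c := c) (show i ≤ N by omega)
    have hcJ := card_arc (c := c + ((i + 1 : ℕ) : ZMod N)) (show n - 1 - i ≤ N by omega)
    have hc' := card_arc (c := c') hn'.le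
    have hcard : (arc N c' n').card = ((arc N c' n') ∩ arc N c i).card +
        ((arc N c' n') ∩ arc N (c + ((i + 1 : ℕ) : ZMod N)) (n - 1 - i)).card := by
      rw [← Finset.card_union_of_disjoint, ← Finset.inter_union_distrib_left,
        Finset.inter_eq_left.2 hsub]
      exact hdis.mono Finset.inter_subset_right Finset.inter_subset_right
    have v1 : Even ((arc N c' n') ∩ arc N c i).card := by
      rcases hd1 with h | h
      · rw [Finset.inter_eq_right.2 h, hcI]; exact hev
      · rw [Finset.disjoint_iff_inter_eq_empty.1 h.symm]; simp
    have v2 : Even ((arc N c' n') ∩ arc N (c + ((i + 1 : ℕ) : ZMod N)) (n - 1 - i)).card := by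
      rcases hd2 with h | h
      · rw [Finset.inter_eq_right.2 h, hcJ]
        rw [Nat.even_iff] at *; rw [Nat.odd_iff] at *; omega
      · rw [Finset.disjoint_iff_inter_eq_empty.1 h.symm]; simp
    have := v1.add v2
    rw [← hcard, hc'] at this
    exact (Nat.not_even_iff_odd.2 ho') this
  · intro ho
    have ho2 : Odd (n - 1 - i) := by rw [Nat.odd_iff] at *; omega
    refine ⟨mem_arc_of c hi, _, _, ?_, ?_, ?_, herase⟩
    · exact (calI1_iff hN _).2 ⟨_, _, by omega, ho, rfl⟩
    · exact (calI1_iff hN _).2 ⟨_, _, by omega, ho2, rfl⟩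
    · exact (spade_iff (arc_conn _) (arc_conn _) ⟨_, start_mem_arc ho.pos⟩
        ⟨_, start_mem_arc ho2.pos⟩).2 hfar

/-! ### Elements of `phi` -/

structure Good {N : ℕ} (B : Finset (Finset (ZMod N))) : Prop where
  arcs : ∀ I ∈ B, ∃ c n, n < N ∧ Odd n ∧ I = arc N c n
  tri : ∀ I ∈ B, ∀ J ∈ B, I = J ∨ Far I J ∨ Ins I J ∨ Ins J I

lemma tri_arc {N : ℕ} {a c : ZMod N} {m n : ℕ} (hm : m < N) (hmo : Odd m) (hn : n < N)
    (hno : Odd n) :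
    (Spade (cadj N) (arc N a m) (arc N c n) ∨ Prec (cadj N) (arc N a m) (arc N c n) ∨
      Prec (cadj N) (arc N c n) (arc N a m)) ↔
    (Far (arc N a m) (arc N c n) ∨ Ins (arc N a m) (arc N c n) ∨ Ins (arc N c n) (arc N a m)) := by
  rw [spade_iff (arc_conn _) (arc_conn _) ⟨_, start_mem_arc hmo.pos⟩ ⟨_, start_mem_arc hno.pos⟩,
    prec_iff hmo.pos hn, prec_iff hno.pos hm]

lemma phi_iff {N : ℕ} (hN : 3 ≤ N) (B : Finset (Finset (ZMod N))) :
    B ∈ phiSet (cadj N) ↔ Good B ∧ ∀ c n, n < N → Odd n → arc N c n ∈ B → ∀ i < n, Odd i →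
      ∃ K ∈ B, Ins K (arc N c n) ∧ c + (i : ZMod N) ∈ K := by
  constructor
  · rintro ⟨h1, h2, h3⟩
    have harcs : ∀ I ∈ B, ∃ c n, n < N ∧ Odd n ∧ I = arc N c n := fun I hI => (calI1_iff hN I).1 (h1 I hI)
    refine ⟨⟨harcs, ?_⟩, ?_⟩
    · intro I hI J hJ
      have := h2 I hI J hJ
      obtain ⟨a, m, hm, hmo, rfl⟩ := harcs I hI
      obtain ⟨c, n, hn, hno, rfl⟩ := harcs J hJ
      rwa [tri_arc hm hmo hn hno] at this
    · intro c n hn hno hJ i hi hio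
      obtain ⟨k, f, hf1, _, hf3⟩ := h3 _ hJ
      have := hf3 ((iev_arc hN hn hno hi).2 hio)
      obtain ⟨j, hj⟩ := Set.mem_iUnion.1 this
      obtain ⟨hB, hp⟩ := hf1 j
      refine ⟨f j, hB, ?_, hj⟩
      obtain ⟨a, m, hm, hmo, he⟩ := harcs _ hB
      rw [he] at hp ⊢
      exact (prec_iff hmo.pos hn).1 hp
  · rintro ⟨⟨harcs, htri⟩, hcov⟩
    refine ⟨fun I hI => (calI1_iff hN I).2 (harcs I hI), ?_, ?_⟩
    · intro I hI J hJ
      have := htri I hI J hJ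
      obtain ⟨a, m, hm, hmo, rfl⟩ := harcs I hI
      obtain ⟨c, n, hn, hno, rfl⟩ := harcs J hJ
      rwa [tri_arc hm hmo hn hno]
    · intro J hJ
      classical
      obtain ⟨c, n, hn, hno, rfl⟩ := harcs J hJ
      let T := B.filter (fun K => Ins K (arc N c n))
      let M := T.filter (fun K => ∀ L ∈ T, K ⊆ L → K = L)
      let eqv := M.equivFin.symm
      have hMT : ∀ K ∈ M, K ∈ T := fun K hK => (Finset.mem_filter.1 hK).1
      refine ⟨M.card, fun j => (eqv j).1, ?_, ?_, ?_⟩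
      · intro j
        obtain ⟨hB, hI⟩ := Finset.mem_filter.1 (hMT _ (eqv j).2)
        refine ⟨hB, ?_⟩
        obtain ⟨a, m, hm, hmo, he⟩ := harcs _ hB
        simp only [he] at hI ⊢
        exact (prec_iff hmo.pos hn).2 hI
      · intro j j' hjj
        have hne : (eqv j).1 ≠ (eqv j').1 := fun h => hjj (eqv.injective (Subtype.ext h))
        obtain ⟨hT, hmax⟩ := Finset.mem_filter.1 (eqv j).2
        obtain ⟨hT', hmax'⟩ := Finset.mem_filter.1 (eqv j').2
        rcases htri _ (Finset.mem_filter.1 hT).1 _ (Finset.mem_filter.1 hT').1 with h | h | h | h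
        · exact absurd h hne
        · exact Finset.disjoint_left.2 fun s hs => (h s hs).1
        · exact absurd (hmax _ hT' fun s hs => (h s hs).1) hne
        · exact absurd (hmax' _ hT fun s hs => (h s hs).1) hne.symm
      · intro s hs
        obtain ⟨i, hi, rfl⟩ := mem_arc.1 hs.1
        have hio := (iev_arc hN hn hno hi).1 hs
        obtain ⟨K, hK, hKI, hKs⟩ := hcov c n hn hno hJ i hi hio
        have hKT : K ∈ T := Finset.mem_filter.2 ⟨hK, hKI⟩
        obtain ⟨L, hKL, hL⟩ := Finset.exists_le_maximal T hKT
        have hLM : L ∈ M := Finset.mem_filter.2 ⟨hL.1, fun L' hL' h => le_antisymm h (hL.2 hL' h)⟩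
        refine Set.mem_iUnion.2 ⟨eqv.symm ⟨L, hLM⟩, ?_⟩
        simpa using hKL hKs

section GoodLemmas

variable {N : ℕ} {B : Finset (Finset (ZMod N))}

lemma up_of_exit (hB : Good B) {J : Finset (ZMod N)} (hJ : J ∈ B) {s t : ZMod N}
    (hst : t = s + 1 ∨ t = s - 1) (hs : s ∈ J) (ht : t ∉ J) {K : Finset (ZMod N)} (hK : K ∈ B)
    (htK : t ∈ K) : Ins J K := by
  rcases hB.tri J hJ K hK with h | h | h | h
  · exact absurd (h ▸ htK) ht
  · rcases hst with rfl | rfl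
    · exact absurd htK (h s hs).2.1
    · exact absurd htK (h s hs).2.2
  · exact h
  · exact absurd (h _ htK).1 ht

lemma up_of_end (hB : Good B) {J : Finset (ZMod N)} (hJ : J ∈ B) {s t : ZMod N}
    (hst : t = s + 1 ∨ t = s - 1) (hs : s ∈ J) (ht : t ∉ J) {K : Finset (ZMod N)} (hK : K ∈ B)
    (hsK : s ∈ K) : K = J ∨ Ins J K := by
  rcases hB.tri J hJ K hK with h | h | h | h
  · exact Or.inl h.symm
  · exact absurd hsK (h s hs).1
  · exact Or.inr h
  · rcases hst with rfl | rfl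
    · exact absurd (h s hsK).2.1 ht
    · exact absurd (h s hsK).2.2 ht

lemma gs_end (hB : Good B) {J : Finset (ZMod N)} (hJ : J ∈ B) {s t : ZMod N}
    (hst : t = s + 1 ∨ t = s - 1) (hs : s ∈ J) (ht : t ∉ J) : gs B s = gs B t + 1 := by
  have : B.filter (fun I => s ∈ I) = insert J (B.filter (fun I => t ∈ I)) := by
    ext K
    simp only [Finset.mem_filter, Finset.mem_insert]
    constructor
    · rintro ⟨hK, hsK⟩
      rcases up_of_end hB hJ hst hs ht hK hsK with h | h
      · exact Or.inl h
      · right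
        refine ⟨hK, ?_⟩
        rcases hst with rfl | rfl
        · exact (h s hs).2.1
        · exact (h s hs).2.2
    · rintro (rfl | ⟨hK, htK⟩)
      · exact ⟨hJ, hs⟩
      · exact ⟨hK, ((up_of_exit hB hJ hst hs ht hK htK) s hs).1⟩
  rw [gs, gs, this, Finset.card_insert_of_notMem]
  simp [ht]

/-- leaving `J` drops strictly below the level of any point of `J` -/
lemma gs_exit_lt (hB : Good B) {J : Finset (ZMod N)} (hJ : J ∈ B) {s t x : ZMod N}
    (hst : t = s + 1 ∨ t = s - 1) (hs : s ∈ J) (ht : t ∉ J) (hx : x ∈ J) : gs B t < gs B x := by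
  apply Finset.card_lt_card
  refine ⟨?_, fun h => ?_⟩
  · intro K hK
    obtain ⟨hK, htK⟩ := Finset.mem_filter.1 hK
    exact Finset.mem_filter.2 ⟨hK, ((up_of_exit hB hJ hst hs ht hK htK) x hx).1⟩
  · exact ht (Finset.mem_filter.1 (h (Finset.mem_filter.2 ⟨hJ, hx⟩))).2

lemma phi_step (hN : 3 ≤ N) (hB : B ∈ phiSet (cadj N)) (s : ZMod N) :
    StepR (gs B s) (gs B (s + 1)) := by
  obtain ⟨hG, hcov⟩ := (phi_iff hN B).1 hB
  by_cases h1 : ∃ J ∈ B, s ∈ J ∧ s + 1 ∉ J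
  · obtain ⟨J, hJ, a, b⟩ := h1
    right; left
    exact gs_end hG hJ (Or.inl rfl) a b
  by_cases h2 : ∃ J ∈ B, s + 1 ∈ J ∧ s ∉ J
  · obtain ⟨J, hJ, a, b⟩ := h2
    left
    exact gs_end hG hJ (Or.inr (by ring)) a b
  push Not at h1 h2
  right; right
  have key : ∀ J ∈ B, s ∉ J := by
    intro J
    induction J using Finset.strongInduction with
    | _ J ih =>
      intro hJ hs
      have hs1 := h1 J hJ hs
      obtain ⟨c, n, hn, hno, rfl⟩ := hG.arcs J hJ
      obtain ⟨i, hi, rfl⟩ := mem_arc.1 hs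
      have e : c + (i : ZMod N) + 1 = c + ((i + 1 : ℕ) : ZMod N) := by push_cast; ring
      rw [e] at hs1 h1 h2
      rw [mem_arc_iff (by omega) (by omega)] at hs1
      have hsub : ∀ K, Ins K (arc N c n) → K ⊂ arc N c n := by
        intro K hK
        refine ⟨fun x hx => (hK x hx).1, fun h => ?_⟩
        exact pred_notMem_arc hn (hK c (h (start_mem_arc hno.pos))).2.2
      rcases Nat.even_or_odd i with hio | hio
      · obtain ⟨K, hK, hI, hm⟩ := hcov c n hn hno hJ (i + 1) hs1 hio.add_one
        exact ih K (hsub K hI) hK (h2 K hK hm)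
      · obtain ⟨K, hK, hI, hm⟩ := hcov c n hn hno hJ i hi hio
        exact ih K (hsub K hI) hK hm
  constructor
  · rw [gs, Finset.card_eq_zero, Finset.filter_eq_empty_iff]; exact fun J hJ => key J hJ
  · rw [gs, Finset.card_eq_zero, Finset.filter_eq_empty_iff]; exact fun J hJ h => key J hJ (h2 J hJ h)

/-- membership is constant along same-level stretches -/
lemma block_const (hB : Good B) {J : Finset (ZMod N)} (hJ : J ∈ B) (x : ZMod N) (n : ℕ)
    (he : gs B (x + (n : ZMod N)) = gs B x) (hk : ∀ k ≤ n, gs B x ≤ gs B (x + (k : ZMod N))) :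
    x + (n : ZMod N) ∈ J ↔ x ∈ J := by
  constructor
  · intro h
    by_contra hx
    have hex : ∃ k, k ≤ n ∧ x + (k : ZMod N) ∈ J := ⟨n, le_rfl, h⟩
    classical
    obtain ⟨k, hkk⟩ : ∃ k, k = Nat.find hex := ⟨_, rfl⟩
    obtain ⟨h1, h2⟩ : k ≤ n ∧ x + (k : ZMod N) ∈ J := hkk ▸ Nat.find_spec hex
    have hk0 : k ≠ 0 := by rintro rfl; simp at h2; exact hx h2
    have h3 : x + ((k - 1 : ℕ) : ZMod N) ∉ J := fun h' =>
      Nat.find_min hex (show k - 1 < Nat.find hex by omega) ⟨by omega, h'⟩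
    have := gs_exit_lt hB hJ (Or.inr (by rw [Nat.cast_sub (by omega)]; push_cast; ring)) h2 h3 h
    have := hk (k - 1) (by omega)
    omega
  · intro h
    by_contra hx
    have hex : ∃ k : ℕ, x + (k : ZMod N) ∉ J := ⟨n, hx⟩
    classical
    obtain ⟨k, hkk⟩ : ∃ k, k = Nat.find hex := ⟨_, rfl⟩
    have h2 : x + (k : ZMod N) ∉ J := hkk ▸ Nat.find_spec hex
    have h1 : k ≤ n := hkk ▸ Nat.find_min' hex hx
    have hk0 : k ≠ 0 := by rintro rfl; simp at h2; exact h2 h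
    have h3 : x + ((k - 1 : ℕ) : ZMod N) ∈ J := by
      by_contra h'
      exact Nat.find_min hex (show k - 1 < Nat.find hex by omega) h'
    have := gs_exit_lt hB hJ (Or.inl (by rw [Nat.cast_sub (by omega)]; push_cast; ring)) h3 h2 h
    have := hk k h1
    omega

/-- description of an arc in `B` through the level function -/
lemma arc_level (hB : Good B) {c : ZMod N} {n : ℕ} (hn : n < N) (hno : Odd n)
    (hJ : arc N c n ∈ B) : gs B (c - 1) < gs B c ∧ gs B (c + (n : ZMod N)) < gs B c ∧
      ∀ i < n, gs B c ≤ gs B (c + (i : ZMod N)) := by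
  have hc := start_mem_arc (c := c) hno.pos
  refine ⟨gs_exit_lt hB hJ (Or.inr rfl) hc (pred_notMem_arc hn) hc, ?_, ?_⟩
  · refine gs_exit_lt hB hJ (s := c + ((n - 1 : ℕ) : ZMod N)) (Or.inl ?_)
      (mem_arc_of c (by have := hno.pos; omega)) (end_notMem_arc hn) hc
    rw [Nat.cast_sub hno.pos]; push_cast; ring
  · intro i hi
    apply Finset.card_le_card
    intro K hK
    obtain ⟨hK, hcK⟩ := Finset.mem_filter.1 hK
    refine Finset.mem_filter.2 ⟨hK, ?_⟩
    rcases up_of_end hB hJ (Or.inr rfl) hc (pred_notMem_arc hn) hK hcK with rfl | h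
    · exact mem_arc_of c hi
    · exact (h _ (mem_arc_of c hi)).1

lemma arc_start_unique {a c : ZMod N} {n : ℕ} (h1 : c ∈ arc N a n) (h2 : c - 1 ∉ arc N a n) :
    a = c := by
  obtain ⟨i, hi, rfl⟩ := mem_arc.1 h1
  rcases Nat.eq_zero_or_pos i with rfl | h
  · simp
  · exfalso
    apply h2
    refine mem_arc.2 ⟨i - 1, by omega, ?_⟩
    rw [Nat.cast_sub (by omega)]; push_cast; ring

lemma gs_inj_sub {B' : Finset (Finset (ZMod N))} (hB : Good B) (hB' : Good B')
    (h : ∀ s, gs B s = gs B' s) : B ⊆ B' := by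
  intro J hJ
  obtain ⟨c, n, hn, hno, rfl⟩ := hB.arcs J hJ
  obtain ⟨l1, l2, l3⟩ := arc_level hB hn hno hJ
  have hex : ∃ J' ∈ B', c ∈ J' ∧ c - 1 ∉ J' := by
    by_contra hcon
    push Not at hcon
    rw [h, h] at l1
    have : gs B' c ≤ gs B' (c - 1) := by
      apply Finset.card_le_card
      intro K hK
      obtain ⟨hK, hcK⟩ := Finset.mem_filter.1 hK
      exact Finset.mem_filter.2 ⟨hK, hcon K hK hcK⟩
    omega
  obtain ⟨J', hJ', hc1, hc2⟩ := hex
  obtain ⟨a, m, hm, hmo, rfl⟩ := hB'.arcs J' hJ'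
  obtain rfl := arc_start_unique hc1 hc2
  obtain ⟨k1, k2, k3⟩ := arc_level hB' hm hmo hJ'
  have : n = m := by
    rcases Nat.lt_trichotomy n m with hlt | h' | hlt
    · have := k3 n hlt
      rw [← h, ← h] at this
      omega
    · exact h'
    · have := l3 m hlt
      rw [h, h] at this
      omega
  rwa [this]

end GoodLemmas

/-! ### Linear algebra -/

def ind {N : ℕ} (I : Finset (ZMod N)) : Vc N := fun s => if s ∈ I then 1 else 0

def epsF {N : ℕ} (B : Finset (Finset (ZMod N))) : Vc N :=
  fun s => ((gs B s * (gs B s + 1) / 2 : ℕ) : ZMod 2)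

section Lin

set_option linter.unusedSectionVars false

variable {N : ℕ} [NeZero N]

lemma sum_eVec (f : Vc N) (I : Finset (ZMod N)) (t : ZMod N) :
    (∑ s ∈ I, f s • eVec N s) t = if t ∈ I then f t else 0 := by
  rw [Finset.sum_apply]
  simp [eVec, Pi.single_apply]

lemma eSum_ebar (I : Finset (ZMod N)) : eSum (ebar N) I = piQ N (ind I) := by
  have : ind I = ∑ s ∈ I, eVec N s := by
    ext t
    have := sum_eVec (fun _ => 1) I t
    simp only [one_smul] at this
    rw [this]; rfl
  rw [this, map_sum]; rfl

lemma epsB_ebar (B : Finset (Finset (ZMod N))) : epsB (ebar N) B = piQ N (epsF B) := by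
  have : epsF B = ∑ s : ZMod N, epsF B s • eVec N s := by
    ext t
    rw [sum_eVec]; simp
  rw [this, map_sum]
  simp only [map_smul]
  rfl

lemma piQ_eq {f g : Vc N} : piQ N f = piQ N g ↔ ∃ ε : ZMod 2, ∀ s, f s = g s + ε := by
  have h1 : ∀ u : ZMod N, (eSum (eVec N) Finset.univ) u = 1 := by
    intro u
    have := sum_eVec (fun _ => 1) Finset.univ u
    simpa [eSum] using this
  rw [piQ, ← sub_eq_zero, ← map_sub, Submodule.mkQ_apply, Submodule.Quotient.mk_eq_zero, radN,
    Submodule.mem_span_singleton]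
  constructor
  · rintro ⟨ε, h⟩
    refine ⟨ε, fun s => ?_⟩
    have := congrFun h s
    simp only [Pi.smul_apply, Pi.sub_apply, h1, smul_eq_mul, mul_one] at this
    rw [this]; ring
  · rintro ⟨ε, h⟩
    refine ⟨ε, ?_⟩
    ext s
    simp [h1, h s]

lemma mem_LB {B : Finset (Finset (ZMod N))} {f : Vc N} (h : piQ N f ∈ LB (ebar N) B) :
    ∃ a : Finset (ZMod N) → ZMod 2, ∃ ε : ZMod 2, ∀ s, f s = (∑ K ∈ B, a K * ind K s) + ε := by
  rw [LB, Submodule.mem_span_image_finset_iff_exists_fun'] at h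
  obtain ⟨a, ha⟩ := h
  simp only [eSum_ebar, ← map_smul, ← map_sum] at ha
  obtain ⟨ε, h⟩ := piQ_eq.1 ha.symm
  refine ⟨a, ε, fun s => ?_⟩
  rw [h s]
  simp [Finset.sum_apply]

lemma sep {B : Finset (Finset (ZMod N))} (hB : Good B) (a : Finset (ZMod N) → ZMod 2)
    (ha : ∃ K ∈ B, a K ≠ 0) : ∃ c n, n < N ∧ Odd n ∧ arc N c n ∈ B ∧
      (∑ K ∈ B, a K * ind K c) = 1 ∧ (∑ K ∈ B, a K * ind K (c - 1)) = 0 ∧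
      (∑ K ∈ B, a K * ind K (c + ((n - 1 : ℕ) : ZMod N))) = 1 ∧
      (∑ K ∈ B, a K * ind K (c + (n : ZMod N))) = 0 := by
  obtain ⟨K0, hK0, haK0⟩ := ha
  obtain ⟨J, -, hJ⟩ := Finset.exists_le_maximal (B.filter (fun K => a K ≠ 0))
    (Finset.mem_filter.2 ⟨hK0, haK0⟩)
  obtain ⟨hJB, haJ⟩ := Finset.mem_filter.1 hJ.1
  have haJ1 : a J = 1 := by
    generalize a J = x at haJ
    revert x; decide
  have key : ∀ s t, (t = s + 1 ∨ t = s - 1) → s ∈ J → t ∉ J →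
      (∑ K ∈ B, a K * ind K s) = 1 ∧ (∑ K ∈ B, a K * ind K t) = 0 := by
    intro s t hst hs ht
    have hmax : ∀ K ∈ B, Ins J K → a K = 0 := by
      intro K hK hI
      by_contra hne
      have := hJ.2 (Finset.mem_filter.2 ⟨hK, hne⟩) (fun x hx => (hI x hx).1)
      rcases hst with rfl | rfl
      · exact ht (this (hI s hs).2.1)
      · exact ht (this (hI s hs).2.2)
    constructor
    · rw [Finset.sum_eq_single_of_mem J hJB]
      · simp [ind, hs, haJ1]
      · intro K hK hne
        by_cases hsK : s ∈ K
        · rcases up_of_end hB hJB hst hs ht hK hsK with h | h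
          · exact absurd h hne
          · simp [hmax K hK h]
        · simp [ind, hsK]
    · apply Finset.sum_eq_zero
      intro K hK
      by_cases htK : t ∈ K
      · simp [hmax K hK (up_of_exit hB hJB hst hs ht hK htK)]
      · simp [ind, htK]
  obtain ⟨c, n, hn, hno, rfl⟩ := hB.arcs J hJB
  have h1 := key c (c - 1) (Or.inr rfl) (start_mem_arc hno.pos) (pred_notMem_arc hn)
  have h2 := key (c + ((n - 1 : ℕ) : ZMod N)) (c + (n : ZMod N))
    (Or.inl (by rw [Nat.cast_sub hno.pos]; push_cast; ring))
    (mem_arc_of c (by have := hno.pos; omega)) (end_notMem_arc hn)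
  exact ⟨c, n, hn, hno, hJB, h1.1, h1.2, h2.1, h2.2⟩

lemma good_indep {B : Finset (Finset (ZMod N))} (hB : Good B) :
    LinearIndependent (ZMod 2) (fun I : {I : Finset (ZMod N) // I ∈ B} => eSum (ebar N) I.1) := by
  have : LinearIndepOn (ZMod 2) (fun I => eSum (ebar N) I) (B : Set (Finset (ZMod N))) := by
    rw [linearIndepOn_finset_iff]
    intro a ha
    by_contra hcon
    push Not at hcon
    simp only [eSum_ebar, ← map_smul, ← map_sum] at ha
    rw [← map_zero (piQ N), piQ_eq] at ha
    obtain ⟨ε, h⟩ := ha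
    obtain ⟨c, n, -, -, -, h1, h2, -, -⟩ := sep hB a hcon
    have e1 := h c
    have e2 := h (c - 1)
    simp only [Finset.sum_apply, Pi.smul_apply, smul_eq_mul, Pi.zero_apply, zero_add] at e1 e2
    rw [h1] at e1
    rw [h2, ← e1] at e2
    exact absurd e2 (by decide)
  exact this

lemma arc_compl {c : ZMod N} {n : ℕ} (hn : n ≤ N) (s : ZMod N) :
    s ∈ arc N (c + (n : ZMod N)) (N - n) ↔ s ∉ arc N c n := by
  obtain ⟨i, hi, rfl⟩ := exists_offset c s
  rw [mem_arc_iff hi hn]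
  constructor
  · intro h
    obtain ⟨j, hj, h⟩ := mem_arc.1 h
    rw [add_assoc, ← Nat.cast_add] at h
    have := add_cast_inj (by omega) hi h
    omega
  · intro h
    refine mem_arc.2 ⟨i - n, by omega, ?_⟩
    rw [Nat.cast_sub (by omega)]; ring

lemma arc_eq_of_bdry {a c : ZMod N} {m n : ℕ} (hm : m < N) (hn : n < N)
    (hm1 : 1 ≤ m) (h1 : a ∈ arc N c n) (h2 : a - 1 ∉ arc N c n)
    (h3 : a + ((m - 1 : ℕ) : ZMod N) ∈ arc N c n) (h4 : a + (m : ZMod N) ∉ arc N c n) :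
    c = a ∧ m = n := by
  obtain rfl := arc_start_unique h1 h2
  rw [mem_arc_iff (by omega) hn.le] at h3 h4
  exact ⟨rfl, by omega⟩

lemma good_mem (hodd : Odd N) {B : Finset (Finset (ZMod N))} (hB : Good B) (I : Finset (ZMod N))
    (hI : ∃ c n, n < N ∧ Odd n ∧ I = arc N c n) : eSum (ebar N) I ∈ LB (ebar N) B ↔ I ∈ B := by
  constructor
  · intro h
    rw [eSum_ebar] at h
    obtain ⟨a, ε, h⟩ := mem_LB h
    obtain ⟨c, n, hn, hno, rfl⟩ := hI
    have hne : ∃ K ∈ B, a K ≠ 0 := by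
      by_contra hcon
      push Not at hcon
      have hz : ∀ s, ∑ K ∈ B, a K * ind K s = 0 := fun s =>
        Finset.sum_eq_zero fun K hK => by simp [hcon K hK]
      have e1 := h c
      have e2 := h (c - 1)
      rw [hz] at e1 e2
      simp only [ind, start_mem_arc hno.pos, pred_notMem_arc hn, if_true, if_false] at e1 e2
      rw [← e1] at e2
      exact absurd e2 (by decide)
    obtain ⟨b, m, hm, hmo, hJ, h1, h2, h3, h4⟩ := sep hB a hne
    have e1 := h b
    have e2 := h (b - 1)
    have e3 := h (b + ((m - 1 : ℕ) : ZMod N))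
    have e4 := h (b + (m : ZMod N))
    rw [h1] at e1
    rw [h2] at e2
    rw [h3] at e3
    rw [h4] at e4
    have hε : ε = 0 ∨ ε = 1 := (show ∀ x : ZMod 2, x = 0 ∨ x = 1 by decide) ε
    rcases hε with rfl | rfl
    · obtain ⟨rfl, rfl⟩ := arc_eq_of_bdry (a := b) (c := c) (m := m) (n := n) hm hn hmo.pos
        (by by_contra hc; simp [ind, hc] at e1) (by intro hc; simp [ind, hc] at e2)
        (by by_contra hc; simp [ind, hc] at e3) (by intro hc; simp [ind, hc] at e4)
      exact hJ
    · exfalso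
      have t : (1 : ZMod 2) + 1 = 0 := by decide
      rw [t] at e1 e3
      obtain ⟨-, hmn⟩ := arc_eq_of_bdry (a := b) (c := c + (n : ZMod N)) (m := m) (n := N - n) hm
        (by have := hno.pos; omega) hmo.pos
        (by rw [arc_compl hn.le]; intro hc; simp [ind, hc] at e1)
        (by rw [arc_compl hn.le, not_not]; by_contra hc; simp [ind, hc] at e2)
        (by rw [arc_compl hn.le]; intro hc; simp [ind, hc] at e3)
        (by rw [arc_compl hn.le, not_not]; by_contra hc; simp [ind, hc] at e4)
      rw [Nat.odd_iff] at *
      omega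
  · intro h
    exact Submodule.subset_span ⟨I, h, rfl⟩

lemma chain_count {S : Type} [DecidableEq S] (C : Finset (Finset S))
    (hC : ∀ I ∈ C, ∀ J ∈ C, I ⊆ J ∨ J ⊆ I) :
    ∑ I ∈ C, (C.filter (fun K => I ⊆ K)).card = C.card * (C.card + 1) / 2 := by
  have h1 : ∑ I ∈ C, (C.filter (fun K => I ⊆ K)).card = ∑ I ∈ C, (C.filter (fun K => K ⊆ I)).card := by
    simp only [Finset.card_filter]
    rw [Finset.sum_comm]
  have h2 : ∀ I ∈ C, (C.filter (fun K => I ⊆ K)).card + (C.filter (fun K => K ⊆ I)).card = C.card + 1 := by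
    intro I hI
    rw [← Finset.card_union_add_card_inter]
    congr 1
    · congr 1
      ext K
      simp only [Finset.mem_union, Finset.mem_filter]
      constructor
      · rintro (h | h) <;> exact h.1
      · intro h
        rcases hC I hI K h with h' | h'
        · exact Or.inl ⟨h, h'⟩
        · exact Or.inr ⟨h, h'⟩
    · rw [Finset.card_eq_one]
      refine ⟨I, ?_⟩
      ext K
      simp only [Finset.mem_inter, Finset.mem_filter, Finset.mem_singleton]
      constructor
      · rintro ⟨⟨_, h⟩, ⟨_, h'⟩⟩
        exact Finset.Subset.antisymm h' h
      · rintro rfl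
        exact ⟨⟨hI, Finset.Subset.refl _⟩, ⟨hI, Finset.Subset.refl _⟩⟩
  have h3 := Finset.sum_congr rfl h2
  rw [Finset.sum_add_distrib, ← h1, Finset.sum_const, smul_eq_mul] at h3
  omega

lemma good_eps {B : Finset (Finset (ZMod N))} (hB : Good B) : epsB (ebar N) B ∈ LB (ebar N) B := by
  rw [epsB_ebar, LB, Submodule.mem_span_image_finset_iff_exists_fun']
  refine ⟨fun I => ((B.filter (fun K => I ⊆ K)).card : ZMod 2), ?_⟩
  simp only [eSum_ebar, ← map_smul, ← map_sum]
  congr 1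
  ext s
  have hC := chain_count (B.filter (fun I => s ∈ I)) (by
    intro I hI J hJ
    obtain ⟨hI, hsI⟩ := Finset.mem_filter.1 hI
    obtain ⟨hJ, hsJ⟩ := Finset.mem_filter.1 hJ
    rcases hB.tri I hI J hJ with h | h | h | h
    · exact Or.inl h.subset
    · exact absurd hsJ (h s hsI).1
    · exact Or.inl fun x hx => (h x hx).1
    · exact Or.inr fun x hx => (h x hx).1)
  simp only [Finset.sum_apply, Pi.smul_apply, smul_eq_mul, epsF, gs, ← hC]
  rw [Finset.sum_filter]
  push_cast
  apply Finset.sum_congr rfl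
  intro I _
  by_cases hs : s ∈ I
  · simp only [ind, hs, if_true, mul_one]
    congr 2
    ext K
    simp only [Finset.mem_filter]
    exact ⟨fun h => ⟨⟨h.1, h.2 hs⟩, h.2⟩, fun h => ⟨h.1.1, h.2⟩⟩
  · simp [ind, hs]

/-- existence of a zero -/
lemma step_zero (hodd : Odd N) (g : ZMod N → ℕ) (hg : ∀ s, StepR (g s) (g (s + 1))) :
    ∃ z, g z = 0 := by
  by_contra hcon
  push Not at hcon
  have := seq_par (fun i => g (i : ZMod N)) (fun i => by simpa using hg (i : ZMod N)) 0 N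
    (fun k _ => Nat.pos_of_ne_zero (hcon _))
  simp at this
  rw [Nat.odd_iff] at hodd
  omega

lemma phi_le (hN : 3 ≤ N) (hodd : Odd N) {B B' : Finset (Finset (ZMod N))}
    (hB : B ∈ phiSet (cadj N)) (hB' : B' ∈ phiSet (cadj N))
    (h : epsB (ebar N) B' ∈ LB (ebar N) B) : ∀ s, gs B' s ≤ gs B s := by
  have hG := ((phi_iff hN B).1 hB).1
  rw [epsB_ebar] at h
  obtain ⟨a, ε, h⟩ := mem_LB h
  have hst := phi_step hN hB
  have hst' := phi_step hN hB'
  have key : ∀ (x : ZMod N) (n : ℕ), gs B (x + (n : ZMod N)) = gs B x →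
      (∀ k ≤ n, gs B x ≤ gs B (x + (k : ZMod N))) →
      pOf (gs B' (x + (n : ZMod N))) = (-1) ^ n * pOf (gs B' x) := by
    intro x n h1 h2
    have := seq_claim (fun i => gs B (x + (i : ZMod N))) (fun i => epsF B' (x + (i : ZMod N)))
      (fun i => pOf (gs B' (x + (i : ZMod N))))
      (fun i => by have := hst (x + (i : ZMod N)); rwa [add_assoc, ← Nat.cast_succ] at this)
      (by
        intro i n h1 h2
        simp only [Nat.cast_add, ← add_assoc] at h1 h2 ⊢
        rw [h, h]
        congr 1
        apply Finset.sum_congr rfl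
        intro K hK
        have := block_const hG hK (x + (i : ZMod N)) n h1 h2
        simp only [ind, this])
      (fun i => by
        have := pOf_step_if _ _ (hst' (x + (i : ZMod N)))
        simp only [Nat.cast_succ, ← add_assoc]
        exact this)
      n 0 (by simpa using h1) (by simpa using h2)
    simpa using this
  have hzero : ∀ s, gs B s = 0 → gs B' s = 0 := by
    intro s hs
    have := key s N (by simp) (fun k _ => by omega)
    simp [hodd.neg_one_pow] at this
    apply pOf_inj
    have h0 : pOf 0 = 0 := rfl
    rw [h0]; omega
  obtain ⟨z, hz⟩ := step_zero hodd (gs B) hst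
  suffices hs : ∀ h s, gs B s = h → gs B' s ≤ h from fun s => hs _ s rfl
  intro h
  induction h with
  | zero => intro s hs; rw [hzero s hs]
  | succ h ih =>
    intro s hs
    have hex : ∃ i : ℕ, gs B (s - (i : ZMod N)) ≤ h := by
      refine ⟨(s - z).val, ?_⟩
      simp [hz]
    obtain ⟨i, hii⟩ : ∃ i, i = Nat.find hex := ⟨_, rfl⟩
    have hi : gs B (s - (i : ZMod N)) ≤ h := hii ▸ Nat.find_spec hex
    have hmin : ∀ j < i, h + 1 ≤ gs B (s - (j : ZMod N)) := fun j hj => by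
      have := Nat.find_min hex (hii ▸ hj)
      omega
    have hi0 : i ≠ 0 := by rintro rfl; simp at hi; omega
    have hstep := hst (s - (i : ZMod N))
    have hstep' := hst' (s - (i : ZMod N))
    have e : s - (i : ZMod N) + 1 = s - ((i - 1 : ℕ) : ZMod N) := by
      rw [Nat.cast_sub (by omega)]; push_cast; ring
    rw [e] at hstep hstep'
    have hm1 := hmin (i - 1) (by omega)
    unfold StepR at hstep hstep'
    have l1 : gs B (s - (i : ZMod N)) = h := by omega
    have l2 : gs B (s - ((i - 1 : ℕ) : ZMod N)) = h + 1 := by omega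
    have hlow : ∀ k ≤ i - 1, h + 1 ≤ gs B (s - ((i - 1 : ℕ) : ZMod N) + (k : ZMod N)) := by
      intro k hk
      have := hmin (i - 1 - k) (by omega)
      rwa [Nat.cast_sub hk, ← sub_add] at this
    have hk := key (s - ((i - 1 : ℕ) : ZMod N)) (i - 1) (by simp [hs, l2]) (by rw [l2]; exact hlow)
    have hpar := seq_par (fun k => gs B (s - ((i - 1 : ℕ) : ZMod N) + (k : ZMod N)))
      (fun k => by
        have := hst (s - ((i - 1 : ℕ) : ZMod N) + (k : ZMod N))
        rwa [add_assoc, ← Nat.cast_succ] at this) 0 (i - 1)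
      (fun k hk => by have := hlow k hk; simp; omega)
    simp [hs, l2] at hpar
    have hev : Even (i - 1) := by rw [Nat.even_iff]; omega
    rw [hev.neg_one_pow, one_mul] at hk
    have hk2 := pOf_inj hk
    simp only [sub_add_cancel] at hk2
    have := ih _ l1
    omega

end Lin

/-! ### Construction of an element of `phi` from a level function -/

section Constr

variable {N : ℕ} [NeZero N]

def CompS (g : ZMod N → ℕ) (h : ℕ) (J : Finset (ZMod N)) : Prop :=
  (∀ s ∈ J, h ≤ g s) ∧ ∀ s ∈ J, (s + 1 ∉ J → g (s + 1) < h) ∧ (s - 1 ∉ J → g (s - 1) < h)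

lemma CompS.next {g : ZMod N → ℕ} {h : ℕ} {J : Finset (ZMod N)} (hJ : CompS g h J) {s : ZMod N}
    (hs : s ∈ J) (hg : h ≤ g (s + 1)) : s + 1 ∈ J := by
  by_contra hc
  have := (hJ.2 s hs).1 hc
  omega

lemma CompS.prev {g : ZMod N → ℕ} {h : ℕ} {J : Finset (ZMod N)} (hJ : CompS g h J) {s : ZMod N}
    (hs : s ∈ J) (hg : h ≤ g (s - 1)) : s - 1 ∈ J := by
  by_contra hc
  have := (hJ.2 s hs).2 hc
  omega

lemma comp_dich {g : ZMod N → ℕ} {h : ℕ} {J : Finset (ZMod N)} (hJ : CompS g h J) (b : ZMod N)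
    (k : ℕ) (hg : ∀ s ∈ arc N b k, h ≤ g s) : arc N b k ⊆ J ∨ Disjoint (arc N b k) J := by
  by_cases hb : b ∈ J
  · left
    intro s hs
    obtain ⟨j, hj, rfl⟩ := mem_arc.1 hs
    clear hs
    induction j with
    | zero => simpa using hb
    | succ j ih =>
      have h1 := ih (by omega)
      have h2 := hg _ (mem_arc_of b hj)
      rw [Nat.cast_succ, ← add_assoc] at h2 ⊢
      exact hJ.next h1 h2
  · right
    rw [Finset.disjoint_left]
    intro s hs
    obtain ⟨j, hj, rfl⟩ := mem_arc.1 hs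
    clear hs
    induction j with
    | zero => simpa using hb
    | succ j ih =>
      have h1 := ih (by omega)
      have h2 := hg _ (mem_arc_of b (show j < k by omega))
      intro h3
      rw [Nat.cast_succ, ← add_assoc] at h3
      apply h1
      have := hJ.prev h3 (by rw [add_sub_cancel_right]; exact h2)
      rwa [add_sub_cancel_right] at this

lemma comp_tri {g : ZMod N → ℕ} (hst : ∀ s, StepR (g s) (g (s + 1))) {h h' : ℕ} {b c : ZMod N}
    {k n : ℕ} (hJ : CompS g h (arc N c n)) (hJ' : CompS g h' (arc N b k)) (hh : h ≤ h') :
    (h = h' ∧ arc N b k = arc N c n) ∨ Far (arc N b k) (arc N c n) ∨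
      (h < h' ∧ Ins (arc N b k) (arc N c n)) := by
  rcases comp_dich hJ b k (fun s hs => hh.trans (hJ'.1 s hs)) with hd | hd
  · rcases Nat.eq_or_lt_of_le hh with rfl | hlt
    · by_cases hne : (arc N b k).Nonempty
      · left
        refine ⟨rfl, Finset.Subset.antisymm hd ?_⟩
        rcases comp_dich hJ' c n (fun s hs => hJ.1 s hs) with hd' | hd'
        · exact hd'
        · obtain ⟨x, hx⟩ := hne
          exact absurd hx (Finset.disjoint_left.1 hd' (hd hx))
      · right; left
        intro s hs
        exact absurd ⟨s, hs⟩ hne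
    · right; right
      refine ⟨hlt, fun s hs => ⟨hd hs, hJ.next (hd hs) ?_, hJ.prev (hd hs) ?_⟩⟩
      · have h1 := hst s
        have h2 := hJ'.1 s hs
        unfold StepR at h1
        omega
      · have h1 := hst (s - 1)
        have h2 := hJ'.1 s hs
        rw [sub_add_cancel] at h1
        unfold StepR at h1
        omega
  · right; left
    intro s hs
    have h0 := Finset.disjoint_left.1 hd hs
    have h2 := hJ'.1 s hs
    refine ⟨h0, fun h1 => ?_, fun h1 => ?_⟩
    · have := hJ.prev h1 (by rw [add_sub_cancel_right]; omega)
      rw [add_sub_cancel_right] at this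
      exact h0 this
    · have := hJ.next h1 (by rw [sub_add_cancel]; omega)
      rw [sub_add_cancel] at this
      exact h0 this

lemma comp_level {g : ZMod N → ℕ} (hst : ∀ s, StepR (g s) (g (s + 1))) {h : ℕ} {c : ZMod N}
    {n : ℕ} (hn : n < N) (hn1 : 1 ≤ n) (hJ : CompS g h (arc N c n)) :
    1 ≤ h ∧ g c = h ∧ Odd n ∧ ∀ i < n, g (c + (i : ZMod N)) % 2 = (h + i) % 2 := by
  have hc := start_mem_arc (c := c) hn1
  have h1 := (hJ.2 c hc).2 (pred_notMem_arc hn)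
  have h2 := hJ.1 c hc
  have h3 := hst (c - 1)
  rw [sub_add_cancel] at h3
  unfold StepR at h3
  have hgc : g c = h := by omega
  have he := mem_arc_of c (show n - 1 < n by omega)
  have e : c + ((n - 1 : ℕ) : ZMod N) + 1 = c + (n : ZMod N) := by
    rw [Nat.cast_sub hn1]; push_cast; ring
  have h4 := (hJ.2 _ he).1 (by rw [e]; exact end_notMem_arc hn)
  have h5 := hst (c + ((n - 1 : ℕ) : ZMod N))
  have h6 := hJ.1 _ he
  unfold StepR at h5
  have hpar : ∀ i < n, g (c + (i : ZMod N)) % 2 = (h + i) % 2 := by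
    intro i hi
    have := seq_par (fun k => g (c + (k : ZMod N)))
      (fun k => by
        have := hst (c + (k : ZMod N))
        rwa [add_assoc, ← Nat.cast_succ] at this) 0 i
      (fun k hk => by
        have := hJ.1 _ (mem_arc_of c (show k < n by omega))
        simp; omega)
    simpa [hgc] using this
  have := hpar (n - 1) (by omega)
  refine ⟨by omega, hgc, ?_, hpar⟩
  rw [Nat.odd_iff]
  omega

lemma comp_exists {g : ZMod N → ℕ} {z s : ZMod N} (hz : g z = 0) {h : ℕ} (h1 : 1 ≤ h)
    (hs : h ≤ g s) : ∃ c n, n < N ∧ 1 ≤ n ∧ s ∈ arc N c n ∧ CompS g h (arc N c n) := by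
  obtain ⟨k, hk, rfl⟩ := exists_offset z s
  have hex2 : ∃ j : ℕ, k < j ∧ g (z + (j : ZMod N)) < h := ⟨N, hk, by simp [hz]; omega⟩
  have hex1 : ∃ i : ℕ, g (z + ((k - i : ℕ) : ZMod N)) < h := ⟨k, by simp [hz]; omega⟩
  obtain ⟨j, hjj⟩ : ∃ j, j = Nat.find hex2 := ⟨_, rfl⟩
  obtain ⟨i, hii⟩ : ∃ i, i = Nat.find hex1 := ⟨_, rfl⟩
  have hj : k < j ∧ g (z + (j : ZMod N)) < h := hjj ▸ Nat.find_spec hex2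
  have hi : g (z + ((k - i : ℕ) : ZMod N)) < h := hii ▸ Nat.find_spec hex1
  have hjN : j ≤ N := hjj ▸ Nat.find_min' hex2 ⟨hk, by simp [hz]; omega⟩
  have hik : i ≤ k := hii ▸ Nat.find_min' hex1 (by simp [hz]; omega)
  have hi0 : i ≠ 0 := by
    rintro rfl
    simp at hi
    omega
  have hmid : ∀ m, k - i < m → m < j → h ≤ g (z + (m : ZMod N)) := by
    intro m hm1 hm2
    rcases Nat.lt_or_ge k m with hkm | hkm
    · by_contra hc
      exact Nat.find_min hex2 (hjj ▸ hm2) ⟨hkm, by omega⟩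
    · by_contra hc
      refine Nat.find_min hex1 (m := k - m) (by omega) ?_
      rw [show k - (k - m) = m by omega]
      omega
  have off : ∀ a : ℕ, z + ((k - i + 1 : ℕ) : ZMod N) + (a : ZMod N) =
      z + ((k - i + 1 + a : ℕ) : ZMod N) := by
    intro a; push_cast; ring
  refine ⟨z + ((k - i + 1 : ℕ) : ZMod N), j - (k - i) - 1, by omega, by omega, ?_, ?_, ?_⟩
  · refine mem_arc.2 ⟨i - 1, by omega, ?_⟩
    rw [off, show k - i + 1 + (i - 1) = k by omega]
  · intro s hs
    obtain ⟨a, ha, rfl⟩ := mem_arc.1 hs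
    rw [off]
    exact hmid _ (by omega) (by omega)
  · intro s hs
    obtain ⟨a, ha, rfl⟩ := mem_arc.1 hs
    constructor
    · intro hnot
      rw [add_assoc, ← Nat.cast_succ] at hnot ⊢
      have : j - (k - i) - 1 ≤ a.succ := by
        by_contra hc
        exact hnot (mem_arc_of _ (by omega))
      rw [off, show k - i + 1 + a.succ = j by omega]
      exact hj.2
    · intro hnot
      rcases Nat.eq_zero_or_pos a with rfl | ha0
      · have : z + ((k - i + 1 : ℕ) : ZMod N) + ((0 : ℕ) : ZMod N) - 1 =
            z + ((k - i : ℕ) : ZMod N) := by push_cast; ring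
        rw [this]; exact hi
      · exfalso
        apply hnot
        refine mem_arc.2 ⟨a - 1, by omega, ?_⟩
        rw [Nat.cast_sub (by omega)]; push_cast; ring

open scoped Classical in
noncomputable def Bof (g : ZMod N → ℕ) : Finset (Finset (ZMod N)) :=
  Finset.univ.filter (fun J => ∃ h c n, n < N ∧ 1 ≤ n ∧ J = arc N c n ∧ CompS g h J)

lemma mem_Bof {g : ZMod N → ℕ} {J : Finset (ZMod N)} :
    J ∈ Bof g ↔ ∃ h c n, n < N ∧ 1 ≤ n ∧ J = arc N c n ∧ CompS g h J := by
  simp [Bof]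

lemma Bof_phi (hN : 3 ≤ N) (hodd : Odd N) (g : ZMod N → ℕ) (hst : ∀ s, StepR (g s) (g (s + 1))) :
    Bof g ∈ phiSet (cadj N) := by
  obtain ⟨z, hz⟩ := step_zero hodd g hst
  rw [phi_iff hN]
  refine ⟨⟨?_, ?_⟩, ?_⟩
  · intro I hI
    obtain ⟨h, c, n, hn, hn1, rfl, hc⟩ := mem_Bof.1 hI
    exact ⟨c, n, hn, (comp_level hst hn hn1 hc).2.2.1, rfl⟩
  · intro I hI J hJ
    obtain ⟨h, c, n, hn, hn1, rfl, hc⟩ := mem_Bof.1 hI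
    obtain ⟨h', c', n', hn', hn1', rfl, hc'⟩ := mem_Bof.1 hJ
    rcases Nat.le_total h h' with hle | hle
    · rcases comp_tri hst hc hc' hle with h | h | h
      · exact Or.inl h.2.symm
      · exact Or.inr (Or.inl h.symm)
      · exact Or.inr (Or.inr (Or.inr h.2))
    · rcases comp_tri hst hc' hc hle with h | h | h
      · exact Or.inl h.2
      · exact Or.inr (Or.inl h)
      · exact Or.inr (Or.inr (Or.inl h.2))
  · intro c n hn hno hJ i hi hio
    obtain ⟨h, _, _, _, _, _, hc⟩ := mem_Bof.1 hJ
    obtain ⟨l1, l2, l3, l4⟩ := comp_level hst hn hno.pos hc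
    have h1 := l4 i hi
    have h2 := hc.1 _ (mem_arc_of c hi)
    rw [Nat.odd_iff] at hio
    obtain ⟨b, k, hk, hk1, hmem, hK⟩ := comp_exists (s := c + (i : ZMod N)) hz (h := h + 1)
      (by omega) (by omega)
    refine ⟨arc N b k, mem_Bof.2 ⟨h + 1, b, k, hk, hk1, rfl, hK⟩, ?_, hmem⟩
    rcases comp_tri hst hc hK (by omega) with h' | h' | h'
    · omega
    · exact absurd (mem_arc_of c hi) (h' _ hmem).1
    · exact h'.2

lemma gs_Bof (hodd : Odd N) (g : ZMod N → ℕ) (hst : ∀ s, StepR (g s) (g (s + 1))) (s : ZMod N) :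
    gs (Bof g) s = g s := by
  obtain ⟨z, hz⟩ := step_zero hodd g hst
  have hex : ∀ h, ∃ J, 1 ≤ h ∧ h ≤ g s →
      s ∈ J ∧ ∃ c n, n < N ∧ 1 ≤ n ∧ J = arc N c n ∧ CompS g h J := by
    intro h
    by_cases hh : 1 ≤ h ∧ h ≤ g s
    · obtain ⟨c, n, hn, hn1, hmem, hc⟩ := comp_exists hz hh.1 hh.2
      exact ⟨arc N c n, fun _ => ⟨hmem, c, n, hn, hn1, rfl, hc⟩⟩
    · exact ⟨∅, fun h => absurd h hh⟩
  choose J hJ using hex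
  have : (Finset.Icc 1 (g s)).card = gs (Bof g) s := by
    apply Finset.card_bij (fun h _ => J h)
    · intro h hh
      obtain ⟨h1, c, n, hn, hn1, h2, h3⟩ := hJ h (Finset.mem_Icc.1 hh)
      exact Finset.mem_filter.2 ⟨mem_Bof.2 ⟨h, c, n, hn, hn1, h2, h3⟩, h1⟩
    · intro h hh h' hh' he
      obtain ⟨-, c, n, hn, hn1, h2, h3⟩ := hJ h (Finset.mem_Icc.1 hh)
      obtain ⟨-, c', n', hn', hn1', h2', h3'⟩ := hJ h' (Finset.mem_Icc.1 hh')
      rw [← he, h2] at h3'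
      rw [h2] at h3
      have e1 := (comp_level hst hn hn1 h3).2.1
      have e2 := (comp_level hst hn hn1 h3').2.1
      omega
    · intro K hK
      obtain ⟨hK, hsK⟩ := Finset.mem_filter.1 hK
      obtain ⟨h, c, n, hn, hn1, rfl, hc⟩ := mem_Bof.1 hK
      have hh : 1 ≤ h ∧ h ≤ g s := ⟨(comp_level hst hn hn1 hc).1, hc.1 s hsK⟩
      refine ⟨h, Finset.mem_Icc.2 hh, ?_⟩
      obtain ⟨h1, c', n', hn', hn1', h2', h3'⟩ := hJ h hh
      rw [h2'] at h1 h3' ⊢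
      rcases comp_tri hst hc h3' le_rfl with h' | h' | h'
      · exact h'.2
      · exact absurd hsK (h' s h1).1
      · omega
  rw [← this]; simp

/-- solving `p s + p (s+1) = d s` on an odd cycle -/
lemma solve_p (hodd : Odd N) (f : Vc N) : ∃ p : ZMod N → ℤ,
    (∀ s, p s + p (s + 1) = 0 ∨ p s + p (s + 1) = 1) ∧
    ∀ s, ((p s + p (s + 1) : ℤ) : ZMod 2) = f s + f (s + 1) := by
  let d : ZMod N → ℤ := fun s => if f s = f (s + 1) then 0 else 1
  let q : ZMod N → ℤ := fun s => ∑ i ∈ Finset.range N, (-1) ^ i * d (s + (i : ZMod N))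
  have hd : ∀ s, ((d s : ℤ) : ZMod 2) = f s + f (s + 1) := by
    intro s
    simp only [d]
    generalize f s = x
    generalize f (s + 1) = y
    revert x y; decide
  have hq : ∀ s, q s + q (s + 1) = 2 * d s := by
    intro s
    have e1 : q s = (∑ i ∈ Finset.range (N - 1), (-1) ^ (i + 1) * d (s + ((i + 1 : ℕ) : ZMod N))) +
        (-1) ^ 0 * d (s + ((0 : ℕ) : ZMod N)) := by
      have := Finset.sum_range_succ' (fun i => (-1) ^ i * d (s + (i : ZMod N))) (N - 1)
      rwa [show N - 1 + 1 = N by have := hodd.pos; omega] at this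
    have e2 : q (s + 1) = (∑ i ∈ Finset.range (N - 1), (-1) ^ i * d (s + 1 + (i : ZMod N))) +
        (-1) ^ (N - 1) * d (s + 1 + ((N - 1 : ℕ) : ZMod N)) := by
      have := Finset.sum_range_succ (fun i => (-1) ^ i * d (s + 1 + (i : ZMod N))) (N - 1)
      rwa [show N - 1 + 1 = N by have := hodd.pos; omega] at this
    have e3 : s + 1 + ((N - 1 : ℕ) : ZMod N) = s := by
      rw [Nat.cast_sub hodd.pos]; simp
    have hev : Even (N - 1) := by rw [Nat.even_iff]; rw [Nat.odd_iff] at hodd; omega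
    rw [e1, e2, e3, hev.neg_one_pow]
    have e4 : (∑ i ∈ Finset.range (N - 1), (-1 : ℤ) ^ (i + 1) * d (s + ((i + 1 : ℕ) : ZMod N))) =
        -∑ i ∈ Finset.range (N - 1), (-1) ^ i * d (s + 1 + (i : ZMod N)) := by
      rw [← Finset.sum_neg_distrib]
      apply Finset.sum_congr rfl
      intro i _
      rw [show s + ((i + 1 : ℕ) : ZMod N) = s + 1 + (i : ZMod N) by push_cast; ring]
      ring
    rw [e4]
    simp
    ring
  have hev : ∀ s, (2 : ℤ) ∣ q s := by
    intro s
    have : ((q s : ℤ) : ZMod 2) = 0 := by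
      simp only [q]
      push_cast
      have h1 : ∀ i ∈ Finset.range N, (-1 : ZMod 2) ^ i * ((d (s + (i : ZMod N)) : ℤ) : ZMod 2) =
          f (s + ((i + 1 : ℕ) : ZMod N)) - f (s + (i : ZMod N)) := by
        intro i _
        rw [hd, show (-1 : ZMod 2) = 1 by decide, one_pow, one_mul,
          show s + ((i + 1 : ℕ) : ZMod N) = s + (i : ZMod N) + 1 by push_cast; ring]
        generalize f (s + (i : ZMod N)) = x
        generalize f (s + (i : ZMod N) + 1) = y
        revert x y; decide
      rw [Finset.sum_congr rfl h1, Finset.sum_range_sub (fun i : ℕ => f (s + (i : ZMod N)))]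
      simp
    exact (ZMod.intCast_zmod_eq_zero_iff_dvd _ 2).1 this
  have hp : ∀ s, q s / 2 + q (s + 1) / 2 = d s := by
    intro s
    have h1 := hev s
    have h2 := hev (s + 1)
    have h3 := hq s
    omega
  refine ⟨fun s => q s / 2, fun s => ?_, fun s => ?_⟩
  · rw [hp]
    simp only [d]
    split_ifs <;> simp
  · rw [hp, hd]

lemma eps_surj (hN : 3 ≤ N) (hodd : Odd N) (v : VbarN N) :
    ∃ B ∈ phiSet (cadj N), epsB (ebar N) B = v := by
  obtain ⟨f, rfl⟩ := Submodule.mkQ_surjective _ v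
  obtain ⟨p, hp1, hp2⟩ := solve_p hodd f
  have hst : ∀ s, StepR (gOf (p s)) (gOf (p (s + 1))) := fun s => gOf_step _ _ (hp1 s)
  refine ⟨Bof (fun s => gOf (p s)), Bof_phi hN hodd _ hst, ?_⟩
  rw [epsB_ebar]
  change _ = piQ N f
  rw [piQ_eq]
  have he : ∀ s, epsF (Bof (fun s => gOf (p s))) s = ((p s : ℤ) : ZMod 2) := by
    intro s
    rw [epsF, gs_Bof hodd _ hst, tri_cast, pOf_gOf]
  refine ⟨((p 0 : ℤ) : ZMod 2) - f 0, fun s => ?_⟩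
  rw [he]
  obtain ⟨i, -, rfl⟩ := exists_offset 0 s
  induction i with
  | zero => simp
  | succ i ih =>
    have h := hp2 (0 + (i : ZMod N))
    rw [show (0 : ZMod N) + ((i + 1 : ℕ) : ZMod N) = 0 + (i : ZMod N) + 1 by push_cast; ring]
    push_cast at h
    generalize f (0 + (i : ZMod N)) = x1 at *
    generalize f (0 + (i : ZMod N) + 1) = x2 at *
    generalize f 0 = x3 at *
    generalize ((p (0 + (i : ZMod N)) : ℤ) : ZMod 2) = x4 at *
    generalize ((p (0 + (i : ZMod N) + 1) : ℤ) : ZMod 2) = x5 at *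
    generalize ((p 0 : ℤ) : ZMod 2) = x6 at *
    clear he hst hp1 hp2
    revert x1 x2 x3 x4 x5 x6
    decide

end Constr
/-- `Vbar = V/(F·e_S)` with the vectors `ebar_s` is perfect, and the
union of the subspaces `L_B` is all of `Vbar`, so `eps` is a bijection from
`phi(Vbar)` onto `Vbar`. -/
theorem statement2 (N : ℕ) [NeZero N] (hN : 3 ≤ N) (hodd : Odd N) :
    IsPerfect (cadj N) (ebar N) ∧
    (⋃ B ∈ phiSet (cadj N), ((LB (ebar N) B : Submodule (ZMod 2) (VbarN N)) :
        Set (VbarN N))) = Set.univ ∧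
    Set.BijOn (epsB (ebar N)) (phiSet (cadj N)) (Set.univ : Set (VbarN N)) := by
  have hgood : ∀ B ∈ phiSet (cadj N), Good B := fun B hB => ((phi_iff hN B).1 hB).1
  have hinj : Set.InjOn (epsB (ebar N)) (phiSet (cadj N)) := by
    intro B hB B' hB' h
    have h1 : ∀ s, gs B' s ≤ gs B s := phi_le hN hodd hB hB' (h ▸ good_eps (hgood B hB))
    have h2 : ∀ s, gs B s ≤ gs B' s := phi_le hN hodd hB' hB (h.symm ▸ good_eps (hgood B' hB'))
    have h3 : ∀ s, gs B s = gs B' s := fun s => le_antisymm (h2 s) (h1 s)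
    exact Finset.Subset.antisymm (gs_inj_sub (hgood B hB) (hgood B' hB') h3)
      (gs_inj_sub (hgood B' hB') (hgood B hB) fun s => (h3 s).symm)
  have hbij : Set.BijOn (epsB (ebar N)) (phiSet (cadj N)) (Set.univ : Set (VbarN N)) :=
    ⟨fun _ _ => Set.mem_univ _, hinj, fun v _ => eps_surj hN hodd v⟩
  have huniv : (⋃ B ∈ phiSet (cadj N), ((LB (ebar N) B : Submodule (ZMod 2) (VbarN N)) :
        Set (VbarN N))) = Set.univ := by
    rw [Set.eq_univ_iff_forall]
    intro v
    obtain ⟨B, hB, rfl⟩ := eps_surj hN hodd v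
    exact Set.mem_biUnion hB (good_eps (hgood B hB))
  refine ⟨⟨?_, ?_, ?_, ?_⟩, huniv, hbij⟩
  · intro B hB
    exact ⟨good_indep (hgood B hB), fun I hI => good_mem hodd (hgood B hB) I ((calI1_iff hN I).1 hI)⟩
  · exact fun B hB => good_eps (hgood B hB)
  · rw [huniv]; exact hbij
  · exact fun B hB B' hB' h => phi_le hN hodd hB hB' h
end

section
/- Suppose the triple (V,<.,.>,(e_s)) is perfect. Define a relation ≤ on phi(V) by: B' ≤ B if there exist B_0 = B', B_1, …, B_k = B in phi(V) with eps(B_i) in L_{B_{i+1}} for i = 0,…,k−1. Then ≤ is a partial order on phi(V) (reflexive, transitive, and antisymmetric). -/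
/-- if `(V,<,>,e)` is perfect then `≤` is a partial order on `phi(V)`. -/
theorem statement3 {S : Type} [DecidableEq S] [Fintype S] {V : Type} [AddCommGroup V]
    [Module (ZMod 2) V] (adj : S → S → Prop) (e : S → V) (hP : IsPerfect adj e) :
    (∀ B ∈ phiSet adj, lePhi adj e B B) ∧
    (∀ B1 B2 B3 : Finset (Finset S),
      lePhi adj e B1 B2 → lePhi adj e B2 B3 → lePhi adj e B1 B3) ∧
    (∀ B B' : Finset (Finset S), lePhi adj e B B' → lePhi adj e B' B → B = B') := by
  have mono : ∀ B' B : Finset (Finset S), lePhi adj e B' B → ∀ s, gs B' s ≤ gs B s := by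
    rintro B' B ⟨k, c, rfl, rfl, hc, hs⟩ s
    have key : ∀ j ≤ k, gs (c 0) s ≤ gs (c j) s := by
      intro j
      induction j with
      | zero => intro _; exact le_rfl
      | succ j ih =>
        intro hj
        exact (ih (by omega)).trans
          (hP.2.2.2 _ (hc _ hj) _ (hc j (by omega)) (hs j (by omega)) s)
    exact key k le_rfl
  refine ⟨?_, ?_, ?_⟩
  · intro B hB
    exact ⟨0, fun _ => B, rfl, rfl, fun _ _ => hB, fun i hi => absurd hi (Nat.not_lt_zero i)⟩
  · rintro B1 B2 B3 ⟨k, c, hc0, hck, hc, hs⟩ ⟨l, d, hd0, hdl, hd, ht⟩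
    refine ⟨k + l, fun i => if i ≤ k then c i else d (i - k), ?_, ?_, ?_, ?_⟩
    · simp [hc0]
    · by_cases hl : l = 0
      · subst hl
        simp [hck, ← hdl, hd0]
      · have : ¬ (k + l ≤ k) := by omega
        simp only [this, if_false, Nat.add_sub_cancel_left, hdl]
    · intro i hi
      by_cases h : i ≤ k
      · simpa only [h, if_true] using hc i h
      · simpa only [h, if_false] using hd (i - k) (by omega)
    · intro i hi
      rcases lt_trichotomy i k with h | h | h
      · have h1 : i ≤ k := by omega
        have h2 : i + 1 ≤ k := by omega
        simpa only [h1, h2, if_true] using hs i h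
      · subst h
        have h2 : ¬ (i + 1 ≤ i) := by omega
        have h3 : i + 1 - i = 0 + 1 := by omega
        have := ht 0 (by omega)
        rw [hd0, ← hck] at this
        simpa only [le_refl, h2, if_true, if_false, h3] using this
      · have h1 : ¬ (i ≤ k) := by omega
        have h2 : ¬ (i + 1 ≤ k) := by omega
        have h3 : i + 1 - k = i - k + 1 := by omega
        simpa only [h1, h2, if_false, h3] using ht (i - k) (by omega)
  · intro B B' h h'
    have hg : ∀ s, gs B s = gs B' s := fun s => le_antisymm (mono _ _ h s) (mono _ _ h' s)
    have heps : epsB e B = epsB e B' := by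
      simp only [epsB, hg]
    have hB : B ∈ phiSet adj := by
      obtain ⟨k, c, rfl, _, hc, _⟩ := h
      exact hc 0 (Nat.zero_le k)
    have hB' : B' ∈ phiSet adj := by
      obtain ⟨k, c, rfl, _, hc, _⟩ := h'
      exact hc 0 (Nat.zero_le k)
    exact hP.2.2.1.injOn hB hB' heps
end
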